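/- arXiv:2011.11884 — 3 statements merged into one kernel-verified Lean document; each statement's English description precedes it below -/
import Mathlib

section
/- Under assumptions (a)–(c) and the SMG iterates driven by randomized reshuffling, choose the diminishing learning rate η_t := γ·n^{1/3}/(t+λ)^{1/3} for some γ > 0 and λ ≥ 0 such that η_1 = γ·n^{1/3}/(1+λ)^{1/3} ≤ 1/(L·√D), where D := max{5/3, 6(5−3β)(Θ+n)/(n(1−β))}. Then for every T ≥ 2, (1/Σ_{t=1}^T η_t) · Σ_{t=1}^T η_t·𝔼[‖∇F(w̃_{t−1})‖²] ≤ (C_3 + C_4·log(T−1+λ)) / ( n^{1/3}·[(T+λ)^{2/3} − (1+λ)^{2/3}] ), where C_3 := 4·(F(w̃_0) − F_*)/((1−β)·γ) + 12·σ²·(5−3β)·L²·γ²/((1−β)·(1+λ)) and C_4 := 6·σ²·(5−3β)·L²·γ²/(1−β). -/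
open Finset

section Sampling

variable {E : Type*} [NormedAddCommGroup E] [InnerProductSpace ℝ E]

theorem sum_perm_comp_mul_right {α M : Type*} [Fintype α] [DecidableEq α] [AddCommMonoid M]
    (H : Equiv.Perm α → M) (ρ : Equiv.Perm α) : ∑ τ, H (τ * ρ) = ∑ τ, H τ :=
  Equiv.sum_comp (Equiv.mulRight ρ) H

/-- Second moment of a partial sum under sampling without replacement. -/
theorem sum_perm_norm_sq_sum_eq {α : Type*} [Fintype α] [DecidableEq α]
    (Y : α → E) (hY : ∑ a, Y a = 0) (S : Finset α) :
    (Fintype.card α : ℝ) * ((Fintype.card α : ℝ) - 1) *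
        ∑ τ : Equiv.Perm α, ‖∑ j ∈ S, Y (τ j)‖ ^ 2 =
      (#S : ℝ) * ((Fintype.card α : ℝ) - #S) *
        ((Fintype.card (Equiv.Perm α) : ℝ) * ∑ a, ‖Y a‖ ^ 2) := by
  set q : α → α → ℝ := fun j k => ∑ τ : Equiv.Perm α, inner ℝ (Y (τ j)) (Y (τ k)) with hq
  have hdiag : ∀ j k, q j j = q k k := by
    intro j k
    have := sum_perm_comp_mul_right (fun τ : Equiv.Perm α => inner ℝ (Y (τ j)) (Y (τ j)))
      (Equiv.swap j k)
    simpa [hq] using this.symm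
  have hoff : ∀ j k l, k ≠ j → l ≠ j → q j k = q j l := by
    intro j k l hk hl
    have := sum_perm_comp_mul_right (fun τ : Equiv.Perm α => inner ℝ (Y (τ j)) (Y (τ k)))
      (Equiv.swap k l)
    simpa [hq, Equiv.swap_apply_of_ne_of_ne hk.symm hl.symm] using this.symm
  have hrow : ∀ j, ∑ k, q j k = 0 := by
    intro j
    simp only [hq]
    rw [sum_comm]
    refine sum_eq_zero fun τ _ => ?_
    rw [← inner_sum, Equiv.sum_comp τ Y, hY, inner_zero_right]
  have htrace : ∀ j, (Fintype.card α : ℝ) * q j j =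
      (Fintype.card (Equiv.Perm α) : ℝ) * ∑ a, ‖Y a‖ ^ 2 := by
    intro j
    have h1 : ∑ k, q k k = (Fintype.card α : ℝ) * q j j := by
      rw [sum_congr rfl fun k _ => hdiag k j]
      simp
    rw [← h1]
    simp only [hq]
    rw [sum_comm]
    have : ∀ τ : Equiv.Perm α, ∑ k, inner ℝ (Y (τ k)) (Y (τ k)) = ∑ a, ‖Y a‖ ^ 2 := by
      intro τ
      rw [Equiv.sum_comp τ (fun a => inner ℝ (Y a) (Y a))]
      simp
    rw [sum_congr rfl fun τ _ => this τ]
    simp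
  have hpart : ∀ j ∈ S, ((Fintype.card α : ℝ) - 1) * ∑ k ∈ S, q j k =
      ((Fintype.card α : ℝ) - #S) * q j j := by
    intro j hj
    have key : ∀ U : Finset α, j ∈ U → ∀ l, l ≠ j →
        ∑ k ∈ U, q j k = q j j + ((#U : ℝ) - 1) * q j l := by
      intro U hU l hl
      rw [← add_sum_erase U _ hU,
        sum_congr rfl fun k hk => hoff j k l (ne_of_mem_erase hk) hl, sum_const,
        card_erase_of_mem hU, nsmul_eq_mul, Nat.cast_sub (card_pos.2 ⟨j, hU⟩)]
      simp
    by_cases h : ∃ l, l ≠ j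
    · obtain ⟨l, hl⟩ := h
      have h1 := key univ (mem_univ j) l hl
      rw [hrow, card_univ] at h1
      rw [key S hj l hl]
      linear_combination ((#S : ℝ) - 1) * (-h1)
    · push Not at h
      have h2 : q j j = 0 := by
        have := hrow j
        rwa [show (univ : Finset α) = {j} by ext k; simp [h k], sum_singleton] at this
      rw [show S = {j} by ext k; simp [h k, hj], sum_singleton, h2]
      simp
  have hexp : ∑ τ : Equiv.Perm α, ‖∑ j ∈ S, Y (τ j)‖ ^ 2 = ∑ j ∈ S, ∑ k ∈ S, q j k := by
    simp only [hq, ← real_inner_self_eq_norm_sq, sum_inner, inner_sum]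
    rw [sum_comm]
    refine sum_congr rfl fun j _ => ?_
    rw [sum_comm]
    exact sum_congr rfl fun k _ => sum_congr rfl fun τ _ => real_inner_comm _ _
  rw [hexp, mul_assoc, mul_sum, sum_congr rfl hpart, mul_sum,
    sum_congr rfl fun j hj => show _ = ((Fintype.card α : ℝ) - #S) *
      ((Fintype.card (Equiv.Perm α) : ℝ) * ∑ a, ‖Y a‖ ^ 2) by rw [← htrace j]; ring,
    sum_const, nsmul_eq_mul, mul_assoc]

theorem sum_range_mul_sub (n : ℕ) :
    ∑ i ∈ range n, (i : ℝ) * ((n : ℝ) - i) = n * (n - 1) * (n + 1) / 6 := by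
  have h : ∀ k : ℕ, ∀ c : ℝ, ∑ i ∈ range k, (i : ℝ) * (c - i) =
      c * (k * (k - 1) / 2) - k * (k - 1) * (2 * k - 1) / 6 := by
    intro k c
    induction k with
    | zero => simp
    | succ k ih => rw [sum_range_succ, ih]; push_cast; ring
  rw [h]; ring

theorem sum_perm_sum_norm_sq_prefix_le (n : ℕ) (Y : Fin n → E) (hY : ∑ a, Y a = 0) :
    ∑ τ : Equiv.Perm (Fin n), ∑ i ∈ range n, ‖∑ j with j.val < i, Y (τ j)‖ ^ 2 ≤
      (Fintype.card (Equiv.Perm (Fin n)) : ℝ) * ((n : ℝ) / 3 * ∑ a, ‖Y a‖ ^ 2) := by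
  rcases Nat.lt_or_ge n 2 with hn | hn
  · refine le_trans (le_of_eq ?_) (by positivity :
      0 ≤ (Fintype.card (Equiv.Perm (Fin n)) : ℝ) * ((n : ℝ) / 3 * ∑ a, ‖Y a‖ ^ 2))
    refine sum_eq_zero fun τ _ => sum_eq_zero fun i hi => ?_
    obtain rfl : i = 0 := by have := mem_range.1 hi; omega
    simp
  · rw [sum_comm]
    have hn' : (2 : ℝ) ≤ n := by exact_mod_cast hn
    have h1 : (n : ℝ) * ((n : ℝ) - 1) * ∑ i ∈ range n,
        ∑ τ : Equiv.Perm (Fin n), ‖∑ j with j.val < i, Y (τ j)‖ ^ 2 =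
        (n * (n - 1) * (n + 1) / 6) *
        ((Fintype.card (Equiv.Perm (Fin n)) : ℝ) * ∑ a, ‖Y a‖ ^ 2) := by
      rw [← sum_range_mul_sub, mul_sum, sum_mul]
      refine sum_congr rfl fun i hi => ?_
      have hc : #{j : Fin n | j.val < i} = i := by
        rw [Fin.card_filter_val_lt, min_eq_right (mem_range.1 hi).le]
      have := sum_perm_norm_sq_sum_eq Y hY {j | j.val < i}
      rwa [hc, Fintype.card_fin] at this
    have hpos : (0 : ℝ) < n * (n - 1) := by nlinarith
    refine le_of_mul_le_mul_left (h1.le.trans ?_) hpos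
    have hX : 0 ≤ (Fintype.card (Equiv.Perm (Fin n)) : ℝ) * ∑ a, ‖Y a‖ ^ 2 := by positivity
    have : ((n : ℝ) + 1) / 6 ≤ n / 3 := by linarith
    calc _ = (n * (n - 1) : ℝ) * ((n + 1) / 6 *
          ((Fintype.card (Equiv.Perm (Fin n)) : ℝ) * ∑ a, ‖Y a‖ ^ 2)) := by ring
      _ ≤ (n * (n - 1) : ℝ) * (n / 3 *
          ((Fintype.card (Equiv.Perm (Fin n)) : ℝ) * ∑ a, ‖Y a‖ ^ 2)) := by gcongr
      _ = _ := by ring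

end Sampling

section Smooth

variable {E : Type*} [NormedAddCommGroup E] [InnerProductSpace ℝ E] [CompleteSpace E]

/-- The quadratic upper bound for a function with Lipschitz gradient. -/
theorem le_add_inner_gradient_add_of_lipschitz {F : E → ℝ} (hF : Differentiable ℝ F) {L : ℝ}
    (hL : ∀ x y, ‖gradient F x - gradient F y‖ ≤ L * ‖x - y‖) (x u : E) :
    F (x + u) ≤ F x + inner ℝ (gradient F x) u + L / 2 * ‖u‖ ^ 2 := by
  set φ : ℝ → ℝ := fun s => F (x + s • u) - s * inner ℝ (gradient F x) u - L / 2 * ‖u‖ ^ 2 * s ^ 2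
    with hφ
  have hd : ∀ s, HasDerivAt φ (inner ℝ (gradient F (x + s • u)) u - inner ℝ (gradient F x) u
      - L * ‖u‖ ^ 2 * s) s := by
    intro s
    have h1 : HasDerivAt (fun s : ℝ => x + s • u) u s := by
      simpa using ((hasDerivAt_id s).smul_const u).const_add x
    have h2 := (hF (x + s • u)).hasGradientAt.hasFDerivAt.comp_hasDerivAt s h1
    have h3 := (h2.sub ((hasDerivAt_id s).mul_const (inner ℝ (gradient F x) u))).sub
      ((hasDerivAt_pow 2 s).const_mul (L / 2 * ‖u‖ ^ 2))
    refine h3.congr_deriv ?_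
    simp
    ring
  have hanti : AntitoneOn φ (Set.Icc 0 1) := by
    refine antitoneOn_of_deriv_nonpos (convex_Icc 0 1)
      (fun s _ => (hd s).continuousAt.continuousWithinAt)
      (fun s _ => (hd s).differentiableAt.differentiableWithinAt) fun s hs => ?_
    rw [interior_Icc] at hs
    rw [(hd s).deriv, ← inner_sub_left]
    have h1 := real_inner_le_norm (gradient F (x + s • u) - gradient F x) u
    have h2 := hL (x + s • u) x
    rw [add_sub_cancel_left, norm_smul, Real.norm_of_nonneg hs.1.le] at h2
    nlinarith [mul_le_mul_of_nonneg_right h2 (norm_nonneg u)]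
  have := hanti (by simp) (by simp) zero_le_one
  simp only [hφ, one_smul, zero_smul, add_zero, one_mul, zero_mul, one_pow, mul_one, ne_eq,
    OfNat.ofNat_ne_zero, not_false_eq_true, zero_pow, mul_zero, sub_zero] at this
  linarith

theorem norm_convex_comb_sq_le {E : Type*} [NormedAddCommGroup E] [InnerProductSpace ℝ E]
    {β : ℝ} (hβ0 : 0 ≤ β) (hβ1 : β ≤ 1) (a b : E) :
    ‖β • a + (1 - β) • b‖ ^ 2 ≤ β * ‖a‖ ^ 2 + (1 - β) * ‖b‖ ^ 2 :=
  ((convexOn_univ_norm (E := E)).pow (fun _ _ => norm_nonneg _) 2).2 trivial trivial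
      hβ0 (sub_nonneg.2 hβ1) (by ring)

/-- A step along a convex combination of gradient estimates `a` and `b`. -/
theorem step_le_of_lipschitz_gradient {F : E → ℝ} (hF : Differentiable ℝ F) {L : ℝ}
    (hL : ∀ x y, ‖gradient F x - gradient F y‖ ≤ L * ‖x - y‖) {η β : ℝ} (hη : 0 ≤ η)
    (hLη : L * η ≤ 1) (hβ0 : 0 ≤ β) (hβ1 : β ≤ 1) (x a b : E) :
    F (x - η • (β • a + (1 - β) • b)) ≤ F x - η / 2 * ‖gradient F x‖ ^ 2 +
      η / 2 * (β * ‖gradient F x - a‖ ^ 2 + (1 - β) * ‖gradient F x - b‖ ^ 2) := by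
  set p := β • a + (1 - β) • b with hp
  have h1 := le_add_inner_gradient_add_of_lipschitz hF hL x (-(η • p))
  rw [← sub_eq_add_neg, inner_neg_right, inner_smul_right, norm_neg, norm_smul,
    Real.norm_of_nonneg hη] at h1
  have h2 := norm_sub_sq_real (gradient F x) p
  have h3 : ‖gradient F x - p‖ ^ 2 ≤
      β * ‖gradient F x - a‖ ^ 2 + (1 - β) * ‖gradient F x - b‖ ^ 2 := by
    have e : gradient F x - p = β • (gradient F x - a) + (1 - β) • (gradient F x - b) := by
      rw [hp]; module
    rw [e]
    exact norm_convex_comb_sq_le hβ0 hβ1 _ _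
  have h4 : 0 ≤ η / 2 * (1 - L * η) * ‖p‖ ^ 2 := by
    have := sub_nonneg.2 hLη
    positivity
  nlinarith [mul_le_mul_of_nonneg_left h3 (div_nonneg hη zero_le_two)]

theorem gradient_average {n : ℕ} {f : Fin n → E → ℝ} (hf : ∀ i, Differentiable ℝ (f i)) (x : E) :
    gradient (fun y => (1 / (n : ℝ)) * ∑ i, f i y) x = (n : ℝ)⁻¹ • ∑ i, gradient (f i) x := by
  refine HasGradientAt.gradient ?_
  rw [hasGradientAt_iff_hasFDerivAt]
  have h := (HasFDerivAt.fun_sum (u := univ)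
    fun i _ => (hf i x).hasGradientAt.hasFDerivAt).const_mul (1 / (n : ℝ))
  refine h.congr_fderiv ?_
  simp [map_sum]

end Smooth

theorem sum_range_sq_le (n : ℕ) : ∑ i ∈ range n, (i : ℝ) ^ 2 ≤ (n : ℝ) ^ 3 / 3 := by
  induction n with
  | zero => simp
  | succ k ih =>
    rw [sum_range_succ]; push_cast
    have : (0 : ℝ) ≤ k := k.cast_nonneg
    nlinarith

section Epoch

variable {E : Type*} [NormedAddCommGroup E] [InnerProductSpace ℝ E]

theorem norm_add_add_sq_le {E : Type*} [NormedAddCommGroup E] (a b c : E) :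
    ‖a + b + c‖ ^ 2 ≤ 3 * (‖a‖ ^ 2 + ‖b‖ ^ 2 + ‖c‖ ^ 2) := by
  have h := norm_add₃_le (a := a) (b := b) (c := c)
  have := norm_nonneg (a + b + c)
  nlinarith [sq_nonneg (‖a‖ - ‖b‖), sq_nonneg (‖a‖ - ‖c‖), sq_nonneg (‖b‖ - ‖c‖)]

theorem norm_sum_sq_le_card_mul {E ι : Type*} [NormedAddCommGroup E] (S : Finset ι) (x : ι → E) :
    ‖∑ j ∈ S, x j‖ ^ 2 ≤ #S * ∑ j ∈ S, ‖x j‖ ^ 2 :=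
  (pow_le_pow_left₀ (norm_nonneg _) (norm_sum_le _ _) 2).trans sq_sum_le_card_mul_sum_sq

/-- A partial sum of gradients `g`, compared with reference gradients `h` whose mean is `p`. -/
theorem norm_sum_sq_le_of_drift {n : ℕ} {g h : ℕ → E} {p : E} {r : ℕ → ℝ}
    (hgh : ∀ i < n, ‖g i - h i‖ ^ 2 ≤ r i) (S : Finset ℕ) (hS : S ⊆ range n) :
    ‖∑ j ∈ S, g j‖ ^ 2 ≤ 3 * (n * ∑ j ∈ range n, r j + ‖∑ j ∈ S, (h j - p)‖ ^ 2 +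
      (#S : ℝ) ^ 2 * ‖p‖ ^ 2) := by
  have e : ∑ j ∈ S, g j = ∑ j ∈ S, (g j - h j) + ∑ j ∈ S, (h j - p) + (#S : ℝ) • p := by
    rw [← sum_add_distrib, Nat.cast_smul_eq_nsmul, ← sum_const, ← sum_add_distrib]
    exact sum_congr rfl fun j _ => by abel
  have h1 : ‖∑ j ∈ S, (g j - h j)‖ ^ 2 ≤ n * ∑ j ∈ range n, r j := by
    have hc : #S ≤ n := by simpa using card_le_card hS
    have hnn : ∀ j ∈ range n, 0 ≤ r j := fun j hj =>
      (sq_nonneg _).trans (hgh j (mem_range.1 hj))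
    calc _ ≤ (#S : ℝ) * ∑ j ∈ S, ‖g j - h j‖ ^ 2 := norm_sum_sq_le_card_mul _ _
      _ ≤ n * ∑ j ∈ range n, r j := by
        refine mul_le_mul (by exact_mod_cast hc) ?_ (by positivity) (by positivity)
        exact (sum_le_sum fun j hj => hgh j (mem_range.1 (hS hj))).trans
          (sum_le_sum_of_subset_of_nonneg hS fun j hj _ => hnn j hj)
  have h2 := norm_add_add_sq_le (∑ j ∈ S, (g j - h j)) (∑ j ∈ S, (h j - p)) ((#S : ℝ) • p)
  rw [norm_smul, mul_pow, Real.norm_of_nonneg (Nat.cast_nonneg _)] at h2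
  rw [e]
  linarith

variable {n : ℕ} {W g h : ℕ → E} {m₀ p : E} {η β L : ℝ}

theorem iterate_sub_eq
    (hW : ∀ i < n, W (i + 1) = W i - (η / (n : ℝ)) • (β • m₀ + (1 - β) • g i))
    {i k : ℕ} (hik : i ≤ k) (hk : k ≤ n) :
    W k - W i = -((η / (n : ℝ)) • (β • (((k - i : ℕ) : ℝ) • m₀) +
      (1 - β) • ∑ j ∈ Ico i k, g j)) := by
  induction k, hik using Nat.le_induction with
  | base => simp
  | succ k hik ih =>
    have ih := ih (by omega)
    rw [hW k (by omega), sum_Ico_succ_top hik, Nat.succ_sub hik,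
      sub_right_comm, ih]
    push_cast
    module

theorem norm_iterate_sub_sq_le (hβ0 : 0 ≤ β) (hβ1 : β ≤ 1)
    (hW : ∀ i < n, W (i + 1) = W i - (η / (n : ℝ)) • (β • m₀ + (1 - β) • g i))
    {i k : ℕ} (hik : i ≤ k) (hk : k ≤ n) :
    ‖W k - W i‖ ^ 2 ≤ η ^ 2 / (n : ℝ) ^ 2 * (β * (((k - i : ℕ) : ℝ) ^ 2 * ‖m₀‖ ^ 2) +
      (1 - β) * ‖∑ j ∈ Ico i k, g j‖ ^ 2) := by
  rw [iterate_sub_eq hW hik hk, norm_neg, norm_smul, mul_pow, Real.norm_eq_abs, sq_abs, div_pow]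
  refine mul_le_mul_of_nonneg_left ?_ (by positivity)
  refine (norm_convex_comb_sq_le hβ0 hβ1 _ _).trans_eq ?_
  rw [norm_smul, mul_pow, Real.norm_of_nonneg (Nat.cast_nonneg _)]

/-- Mean squared distance of the inner iterates of an epoch to its first iterate. -/
theorem forward_drift_le (hn : 1 ≤ n) (hβ0 : 0 ≤ β) (hβ1 : β ≤ 1)
    (hW : ∀ i < n, W (i + 1) = W i - (η / (n : ℝ)) • (β • m₀ + (1 - β) • g i))
    (hgh : ∀ i < n, ‖g i - h i‖ ^ 2 ≤ L ^ 2 * ‖W i - W 0‖ ^ 2) :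
    (n : ℝ)⁻¹ * ∑ i ∈ range n, ‖W i - W 0‖ ^ 2 ≤ η ^ 2 * (β / 3 * ‖m₀‖ ^ 2 + 3 * (1 - β) *
      (L ^ 2 * ((n : ℝ)⁻¹ * ∑ i ∈ range n, ‖W i - W 0‖ ^ 2) +
        ((n : ℝ) ^ 3)⁻¹ * ∑ i ∈ range n, ‖∑ j ∈ range i, (h j - p)‖ ^ 2 + ‖p‖ ^ 2 / 3)) := by
  have hn0 : (0 : ℝ) < n := by exact_mod_cast hn
  have hβ := sub_nonneg.2 hβ1
  set s := ∑ i ∈ range n, ‖W i - W 0‖ ^ 2 with hs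
  set q := ∑ i ∈ range n, ‖∑ j ∈ range i, (h j - p)‖ ^ 2 with hq
  have h1 : ∀ i ∈ range n, ‖W i - W 0‖ ^ 2 ≤ η ^ 2 / (n : ℝ) ^ 2 * (β * ((i : ℝ) ^ 2 * ‖m₀‖ ^ 2) +
      (1 - β) * (3 * (n * (L ^ 2 * s) + ‖∑ j ∈ range i, (h j - p)‖ ^ 2 +
        (i : ℝ) ^ 2 * ‖p‖ ^ 2))) := by
    intro i hi
    have hin := (mem_range.1 hi).le
    refine (norm_iterate_sub_sq_le hβ0 hβ1 hW (Nat.zero_le i) hin).trans ?_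
    rw [Nat.sub_zero, ← range_eq_Ico]
    have := norm_sum_sq_le_of_drift (p := p) hgh (range i) (range_subset_range.2 hin)
    rw [card_range, ← mul_sum] at this
    gcongr
  have h2 := sum_le_sum h1
  rw [← mul_sum, sum_add_distrib, ← mul_sum, ← mul_sum, ← mul_sum, ← sum_mul, sum_add_distrib,
    sum_add_distrib, sum_const, card_range, nsmul_eq_mul, ← sum_mul, ← hs, ← hq] at h2
  have h3 := sum_range_sq_le n
  have h4 : s ≤ η ^ 2 / (n : ℝ) ^ 2 * (β * ((n : ℝ) ^ 3 / 3 * ‖m₀‖ ^ 2) +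
      (1 - β) * (3 * (n * (n * (L ^ 2 * s)) + q + (n : ℝ) ^ 3 / 3 * ‖p‖ ^ 2))) :=
    h2.trans (by gcongr)
  refine (mul_le_mul_of_nonneg_left h4 (inv_nonneg.2 hn0.le)).trans_eq ?_
  field_simp

/-- Mean squared distance of the inner iterates of an epoch to its last iterate. -/
theorem backward_drift_le (hn : 1 ≤ n) (hβ0 : 0 ≤ β) (hβ1 : β ≤ 1)
    (hW : ∀ i < n, W (i + 1) = W i - (η / (n : ℝ)) • (β • m₀ + (1 - β) • g i))
    (hgh : ∀ i < n, ‖g i - h i‖ ^ 2 ≤ L ^ 2 * ‖W i - W 0‖ ^ 2)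
    (hp : ∑ j ∈ range n, (h j - p) = 0) :
    (n : ℝ)⁻¹ * ∑ i ∈ range n, ‖W n - W i‖ ^ 2 ≤ η ^ 2 * (β * ‖m₀‖ ^ 2 + 3 * (1 - β) *
      (L ^ 2 * ((n : ℝ)⁻¹ * ∑ i ∈ range n, ‖W i - W 0‖ ^ 2) +
        ((n : ℝ) ^ 3)⁻¹ * ∑ i ∈ range n, ‖∑ j ∈ range i, (h j - p)‖ ^ 2 + ‖p‖ ^ 2)) := by
  have hn0 : (0 : ℝ) < n := by exact_mod_cast hn
  have hβ := sub_nonneg.2 hβ1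
  set s := ∑ i ∈ range n, ‖W i - W 0‖ ^ 2 with hs
  set q := ∑ i ∈ range n, ‖∑ j ∈ range i, (h j - p)‖ ^ 2 with hq
  have h1 : ∀ i ∈ range n, ‖W n - W i‖ ^ 2 ≤ η ^ 2 / (n : ℝ) ^ 2 * (β * ((n : ℝ) ^ 2 * ‖m₀‖ ^ 2) +
      (1 - β) * (3 * (n * (L ^ 2 * s) + ‖∑ j ∈ range i, (h j - p)‖ ^ 2 +
        (n : ℝ) ^ 2 * ‖p‖ ^ 2))) := by
    intro i hi
    have hin := (mem_range.1 hi).le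
    refine (norm_iterate_sub_sq_le hβ0 hβ1 hW hin le_rfl).trans ?_
    have hsub : Ico i n ⊆ range n := by
      rw [range_eq_Ico]; exact Ico_subset_Ico_left (Nat.zero_le i)
    have := norm_sum_sq_le_of_drift (p := p) hgh (Ico i n) hsub
    rw [Nat.card_Ico, ← mul_sum, sum_Ico_eq_sub (fun j => h j - p) hin, hp, zero_sub, norm_neg] at this
    have hni : ((n - i : ℕ) : ℝ) ≤ n := by exact_mod_cast Nat.sub_le n i
    have hx : ‖∑ j ∈ Ico i n, g j‖ ^ 2 ≤ 3 * (n * (L ^ 2 * s) +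
        ‖∑ j ∈ range i, (h j - p)‖ ^ 2 + (n : ℝ) ^ 2 * ‖p‖ ^ 2) := this.trans (by gcongr)
    gcongr
  have h2 := sum_le_sum h1
  rw [← mul_sum, sum_add_distrib, sum_const, ← mul_sum, ← mul_sum, sum_add_distrib,
    sum_add_distrib, sum_const, sum_const, card_range, nsmul_eq_mul, nsmul_eq_mul, nsmul_eq_mul,
    ← hq] at h2
  refine (mul_le_mul_of_nonneg_left h2 (inv_nonneg.2 hn0.le)).trans_eq ?_
  field_simp

theorem norm_sub_average_sq_le (hn : 1 ≤ n) {h : ℕ → E} {p : E} {r : ℕ → ℝ}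
    (hgh : ∀ i < n, ‖h i - g i‖ ^ 2 ≤ L ^ 2 * r i) (hp : p = (n : ℝ)⁻¹ • ∑ j ∈ range n, h j) :
    ‖p - (n : ℝ)⁻¹ • ∑ j ∈ range n, g j‖ ^ 2 ≤ L ^ 2 * ((n : ℝ)⁻¹ * ∑ i ∈ range n, r i) := by
  have hn0 : (0 : ℝ) < n := by exact_mod_cast hn
  rw [hp, ← smul_sub, ← sum_sub_distrib, norm_smul, mul_pow, Real.norm_eq_abs, sq_abs]
  have h1 := norm_sum_sq_le_card_mul (range n) (fun j => h j - g j)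
  have h2 : ∑ j ∈ range n, ‖h j - g j‖ ^ 2 ≤ L ^ 2 * ∑ j ∈ range n, r j := by
    rw [mul_sum]; exact sum_le_sum fun j hj => hgh j (mem_range.1 hj)
  rw [card_range] at h1
  calc _ ≤ ((n : ℝ)⁻¹) ^ 2 * (n * (L ^ 2 * ∑ j ∈ range n, r j)) := by
        gcongr; exact h1.trans (by gcongr)
    _ = _ := by field_simp

end Epoch

theorem sum_filter_val_lt_eq_sum_range {M : Type*} [AddCommMonoid M] {n i : ℕ} (hi : i ≤ n)
    (y : ℕ → M) : ∑ j : Fin n with j.val < i, y j = ∑ j ∈ range i, y j := by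
  rw [sum_filter, Fin.sum_univ_eq_sum_range (fun j => if j < i then y j else 0) n, ← sum_filter]
  refine sum_congr ?_ fun _ _ => rfl
  ext j
  simp only [mem_filter, mem_range]
  omega

theorem potential_error_le {A B φ s M β ε : ℝ} (hA0 : 0 ≤ A) (hφ : 0 ≤ φ) (hs : 0 ≤ s)
    (hM : 0 ≤ M) (hβ0 : 0 ≤ β) (hβ1 : β ≤ 1) (hε0 : 0 ≤ ε) (hε : 30 * ε ≤ 1)
    (hεβ : 12 * ε ≤ 1 - β)
    (hA : A ≤ ε * (β / 3 * s + 3 * (1 - β) * (A + M + φ / 3)))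
    (hB : B ≤ ε * (β * s + 3 * (1 - β) * (A + M + φ))) :
    (1 - β) / 2 * A + β / 2 * B + (1 - β) / 18 * (2 * φ + 2 * A) ≤
      (1 - β) / 18 * s + (1 - β) * (φ / 9 + ε * (5 / 2 * φ + 4 * M)) := by
  have hδ : 0 ≤ 1 - β := sub_nonneg.2 hβ1
  have hA' : A ≤ 10 / 9 * (ε * (s / 3 + 3 * M + φ)) := by
    have h1 : ε * (β / 3 * s + 3 * (1 - β) * (A + M + φ / 3)) ≤
        ε * (s / 3 + 3 * (A + M + φ / 3)) := by
      refine mul_le_mul_of_nonneg_left ?_ hε0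
      nlinarith [mul_nonneg hδ hs, mul_nonneg hβ0 (by positivity : 0 ≤ A + M + φ / 3)]
    nlinarith [mul_le_mul_of_nonneg_right hε hA0]
  have hB' : β / 2 * B ≤ (1 - β) * (s / 24 + A / 20 + 3 / 2 * (ε * (M + φ))) := by
    have h1 : β / 2 * B ≤ β / 2 * (ε * (β * s + 3 * (1 - β) * (A + M + φ))) :=
      mul_le_mul_of_nonneg_left hB (by positivity)
    have h2 : β * β * (ε * s) ≤ (1 - β) * s / 12 := by
      have h3 : β * β ≤ 1 := by nlinarith
      have h4 := mul_le_mul_of_nonneg_right hεβ hs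
      nlinarith [mul_le_mul_of_nonneg_right h3 (mul_nonneg hε0 hs)]
    have h5 : β * ((1 - β) * (ε * (A + M + φ))) ≤ (1 - β) * (ε * (A + M + φ)) := by
      have : 0 ≤ (1 - β) * (ε * (A + M + φ)) := by positivity
      nlinarith
    have h6 : (1 - β) * (ε * A) ≤ (1 - β) * (A / 30) := by
      refine mul_le_mul_of_nonneg_left ?_ hδ
      nlinarith
    linarith
  have hεs : ε * s ≤ s / 30 := by nlinarith
  have hcore : A / 2 + (s / 24 + A / 20 + 3 / 2 * (ε * (M + φ))) + (2 * φ + 2 * A) / 18 ≤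
      s / 18 + (φ / 9 + ε * (5 / 2 * φ + 4 * M)) := by
    have : 0 ≤ ε * φ := by positivity
    have : 0 ≤ ε * M := by positivity
    linarith
  have := mul_le_mul_of_nonneg_left hcore hδ
  linarith

section Potential

variable {E : Type*} [NormedAddCommGroup E] [InnerProductSpace ℝ E] [CompleteSpace E]

theorem lipschitz_gradient_average {n : ℕ} (hn : 1 ≤ n) {f : Fin n → E → ℝ}
    (hf : ∀ i, Differentiable ℝ (f i)) {L : ℝ}
    (hL : ∀ i x y, ‖gradient (f i) x - gradient (f i) y‖ ≤ L * ‖x - y‖) (x y : E) :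
    ‖gradient (fun y => (1 / (n : ℝ)) * ∑ i, f i y) x -
      gradient (fun y => (1 / (n : ℝ)) * ∑ i, f i y) y‖ ≤ L * ‖x - y‖ := by
  have hn0 : (0 : ℝ) < n := by exact_mod_cast hn
  rw [gradient_average hf, gradient_average hf, ← smul_sub, ← sum_sub_distrib, norm_smul,
    norm_inv, Real.norm_of_nonneg hn0.le, inv_mul_le_iff₀ hn0]
  refine (norm_sum_le_of_le univ fun i _ => hL i x y).trans_eq ?_
  simp

/-- One epoch decreases the potential, up to the squared fluctuation of the partial sums of the
permuted gradients at the start of the epoch. -/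
theorem epoch_potential_le {n : ℕ} (hn : 1 ≤ n) {f : Fin n → E → ℝ}
    (hf : ∀ i, Differentiable ℝ (f i)) {F : E → ℝ}
    (hF : F = fun x => (1 / (n : ℝ)) * ∑ i, f i x) {L : ℝ}
    (hsmooth : ∀ i x y, ‖gradient (f i) x - gradient (f i) y‖ ≤ L * ‖x - y‖)
    {β η : ℝ} (hβ0 : 0 ≤ β) (hβ1 : β ≤ 1) (hη : 0 ≤ η) (hε : 30 * (L ^ 2 * η ^ 2) ≤ 1)
    (hεβ : 12 * (L ^ 2 * η ^ 2) ≤ 1 - β) (π : Equiv.Perm (Fin n)) {W g : ℕ → E} {m₀ : E}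
    (hg : ∀ i, ∀ hi : i < n, g i = gradient (f (π ⟨i, hi⟩)) (W i))
    (hW : ∀ i < n, W (i + 1) = W i - (η / (n : ℝ)) • (β • m₀ + (1 - β) • g i)) :
    F (W n) + η * (β / 2 * ‖gradient F (W n) - (n : ℝ)⁻¹ • ∑ j ∈ range n, g j‖ ^ 2 +
        (1 - β) / 18 * ‖(n : ℝ)⁻¹ • ∑ j ∈ range n, g j‖ ^ 2) ≤
      F (W 0) + η * (β / 2 * ‖gradient F (W 0) - m₀‖ ^ 2 + (1 - β) / 18 * ‖m₀‖ ^ 2) -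
        η / 2 * ‖gradient F (W 0)‖ ^ 2 + η * ((1 - β) * (‖gradient F (W 0)‖ ^ 2 / 9 +
          L ^ 2 * η ^ 2 * (5 / 2 * ‖gradient F (W 0)‖ ^ 2 + 4 * (((n : ℝ) ^ 3)⁻¹ *
            ∑ i ∈ range n, ‖∑ j with j.val < i,
              (gradient (f (π j)) (W 0) - gradient F (W 0))‖ ^ 2)))) := by
  have hn0 : (0 : ℝ) < n := by exact_mod_cast hn
  set G := (n : ℝ)⁻¹ • ∑ j ∈ range n, g j with hG
  set p := gradient F (W 0) with hp
  set h : E → ℕ → E := fun x j => if hj : j < n then gradient (f (π ⟨j, hj⟩)) x else 0 with hh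
  have hmean : ∀ x, gradient F x = (n : ℝ)⁻¹ • ∑ j ∈ range n, h x j := by
    intro x
    rw [hF, gradient_average hf, ← Fin.sum_univ_eq_sum_range,
      ← Equiv.sum_comp π fun i => gradient (f i) x]
    simp [hh]
  have hdist : ∀ x, ∀ i < n, ‖h x i - g i‖ ^ 2 ≤ L ^ 2 * ‖x - W i‖ ^ 2 := by
    intro x i hi
    rw [← mul_pow, hg i hi]
    simp only [hh, hi, dif_pos]
    exact pow_le_pow_left₀ (norm_nonneg _) (hsmooth _ _ _) 2
  have hgh : ∀ i < n, ‖g i - h (W 0) i‖ ^ 2 ≤ L ^ 2 * ‖W i - W 0‖ ^ 2 := by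
    intro i hi
    rw [norm_sub_rev, norm_sub_rev (W i)]
    exact hdist _ i hi
  have hp0 : ∑ j ∈ range n, (h (W 0) j - p) = 0 := by
    rw [sum_sub_distrib, sum_const, card_range, hp, hmean, ← Nat.cast_smul_eq_nsmul ℝ,
      smul_smul, mul_inv_cancel₀ hn0.ne', one_smul, sub_self]
  have hfluct : ∀ i ∈ range n, ‖∑ j with j.val < i, (gradient (f (π j)) (W 0) - p)‖ ^ 2 =
      ‖∑ j ∈ range i, (h (W 0) j - p)‖ ^ 2 := by
    intro i hi
    rw [← sum_filter_val_lt_eq_sum_range (mem_range.1 hi).le fun j => h (W 0) j - p]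
    simp [hh]
  rw [sum_congr rfl hfluct]
  set a := (n : ℝ)⁻¹ * ∑ i ∈ range n, ‖W i - W 0‖ ^ 2 with ha
  set b := (n : ℝ)⁻¹ * ∑ i ∈ range n, ‖W n - W i‖ ^ 2 with hb
  set M := ((n : ℝ) ^ 3)⁻¹ * ∑ i ∈ range n, ‖∑ j ∈ range i, (h (W 0) j - p)‖ ^ 2 with hMdef
  have ha_le := forward_drift_le (p := p) hn hβ0 hβ1 hW hgh
  have hb_le := backward_drift_le hn hβ0 hβ1 hW hgh hp0
  rw [← ha, ← hMdef] at ha_le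
  rw [← ha, ← hb, ← hMdef] at hb_le
  have hpG : ‖p - G‖ ^ 2 ≤ L ^ 2 * a := by
    refine norm_sub_average_sq_le (r := fun i => ‖W i - W 0‖ ^ 2) hn (fun i hi => ?_) (hmean _)
    simp only [norm_sub_rev (W i)]
    exact hdist _ i hi
  have hqG : ‖gradient F (W n) - G‖ ^ 2 ≤ L ^ 2 * b :=
    norm_sub_average_sq_le hn (hdist _) (hmean _)
  have hGsq : ‖G‖ ^ 2 ≤ 2 * ‖p‖ ^ 2 + 2 * (L ^ 2 * a) := by
    have h1 : ‖G‖ ≤ ‖p‖ + ‖p - G‖ := by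
      simpa using norm_sub_le p (p - G)
    nlinarith [norm_nonneg G, sq_nonneg (‖p‖ - ‖p - G‖)]
  have hWn : W n = W 0 - η • (β • m₀ + (1 - β) • G) := by
    have h1 := iterate_sub_eq hW (Nat.zero_le n) le_rfl
    rw [← range_eq_Ico, Nat.sub_zero] at h1
    have h2 : (η / (n : ℝ)) • (β • ((n : ℝ) • m₀) + (1 - β) • ∑ j ∈ range n, g j) =
        η • (β • m₀ + (1 - β) • G) := by
      rw [hG]
      match_scalars <;> field_simp
    rw [← h2, sub_eq_add_neg, ← h1, add_sub_cancel]
  have hFd : Differentiable ℝ F := by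
    rw [hF]
    exact (Differentiable.fun_sum fun i _ => hf i).const_mul _
  have hFL : ∀ x y, ‖gradient F x - gradient F y‖ ≤ L * ‖x - y‖ := by
    rw [hF]; exact lipschitz_gradient_average hn hf hsmooth
  have hLη : L * η ≤ 1 := by nlinarith
  have hstep := step_le_of_lipschitz_gradient hFd hFL hη hLη hβ0 hβ1 (W 0) m₀ G
  rw [← hWn, ← hp] at hstep
  have hL2 := sq_nonneg L
  have herr := potential_error_le (A := L ^ 2 * a) (B := L ^ 2 * b) (φ := ‖p‖ ^ 2)
    (s := ‖m₀‖ ^ 2) (M := M) (by positivity) (by positivity) (by positivity) (by positivity)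
    hβ0 hβ1 (by positivity) hε hεβ
    ((mul_le_mul_of_nonneg_left ha_le hL2).trans_eq (by ring))
    ((mul_le_mul_of_nonneg_left hb_le hL2).trans_eq (by ring))
  have hδ : 0 ≤ 1 - β := sub_nonneg.2 hβ1
  have htot : (1 - β) / 2 * ‖p - G‖ ^ 2 + β / 2 * ‖gradient F (W n) - G‖ ^ 2 +
      (1 - β) / 18 * ‖G‖ ^ 2 ≤ (1 - β) / 18 * ‖m₀‖ ^ 2 +
        (1 - β) * (‖p‖ ^ 2 / 9 + L ^ 2 * η ^ 2 * (5 / 2 * ‖p‖ ^ 2 + 4 * M)) :=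
    le_trans (by gcongr) herr
  have := mul_le_mul_of_nonneg_left htot hη
  linarith

end Potential

section Reshuffling

theorem mul_sum_eq_sum_sum_mul_mulSingle {ι P : Type*} [Fintype ι] [DecidableEq ι] [Group P]
    [Fintype P] (k : ι) (H : (ι → P) → ℝ) :
    (Fintype.card P : ℝ) * ∑ ω, H ω = ∑ ω : ι → P, ∑ τ : P, H (ω * Pi.mulSingle k τ) := by
  have hshift : ∀ τ : P, ∑ ω : ι → P, H (ω * Pi.mulSingle k τ) = ∑ ω, H ω := fun τ =>
    Equiv.sum_comp (Equiv.mulRight (Pi.mulSingle k τ : ι → P)) H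
  rw [sum_comm, sum_congr rfl fun τ _ => hshift τ, sum_const, nsmul_eq_mul, card_univ]

/-- The fluctuation of partial sums over a fresh uniform permutation, averaged over all epochs. -/
theorem sum_pi_perm_prefix_le {E X : Type*} [NormedAddCommGroup E] [InnerProductSpace ℝ E]
    {n T : ℕ} (k : Fin T) (x : (Fin T → Equiv.Perm (Fin n)) → X)
    (hx : ∀ ω τ, x (ω * Pi.mulSingle k τ) = x ω) (Y : X → Fin n → E) (hY : ∀ z, ∑ a, Y z a = 0) :
    ∑ ω : Fin T → Equiv.Perm (Fin n), ∑ i ∈ range n, ‖∑ j with j.val < i, Y (x ω) (ω k j)‖ ^ 2 ≤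
      ∑ ω : Fin T → Equiv.Perm (Fin n), (n : ℝ) / 3 * ∑ a, ‖Y (x ω) a‖ ^ 2 := by
  have hc : (0 : ℝ) < Fintype.card (Equiv.Perm (Fin n)) := by
    exact_mod_cast Fintype.card_pos (α := Equiv.Perm (Fin n))
  refine le_of_mul_le_mul_left ?_ hc
  rw [mul_sum_eq_sum_sum_mul_mulSingle k, mul_sum]
  refine sum_le_sum fun ω _ => ?_
  have h1 := sum_perm_sum_norm_sq_prefix_le n (fun a => Y (x ω) (ω k a))
    (by rw [Equiv.sum_comp (ω k) (Y (x ω)), hY])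
  rw [Equiv.sum_comp (ω k) (fun a => ‖Y (x ω) a‖ ^ 2)] at h1
  simpa only [hx, Pi.mul_apply, Pi.mulSingle_eq_same, Equiv.Perm.mul_apply] using h1

/-- The iterates after `s` epochs depend only on the first `s` permutations. -/
theorem smg_iterates_congr {E : Type*} [NormedAddCommGroup E] [NormedSpace ℝ E] {n T : ℕ}
    {G : Fin n → E → E} {β : ℝ} {η : ℕ → ℝ} {w₀ : E}
    {w m v g : (Fin T → Equiv.Perm (Fin n)) → ℕ → ℕ → E}
    {wt mt : (Fin T → Equiv.Perm (Fin n)) → ℕ → E}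
    (hwt0 : ∀ ω, wt ω 0 = w₀) (hmt0 : ∀ ω, mt ω 0 = 0)
    (hw0 : ∀ ω t, 1 ≤ t → t ≤ T → w ω t 0 = wt ω (t - 1))
    (hm0 : ∀ ω t, 1 ≤ t → t ≤ T → m ω t 0 = mt ω (t - 1))
    (hv0 : ∀ ω t, 1 ≤ t → t ≤ T → v ω t 0 = 0)
    (hg : ∀ ω t, ∀ ht1 : 1 ≤ t, ∀ ht2 : t ≤ T, ∀ i, ∀ hi : i < n,
        g ω t i = G (ω ⟨t - 1, by omega⟩ ⟨i, hi⟩) (w ω t i))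
    (hm1 : ∀ ω t, 1 ≤ t → t ≤ T → ∀ i, i < n →
        m ω t (i + 1) = β • m ω t 0 + (1 - β) • g ω t i)
    (hv1 : ∀ ω t, 1 ≤ t → t ≤ T → ∀ i, i < n →
        v ω t (i + 1) = v ω t i + ((n : ℝ))⁻¹ • g ω t i)
    (hw1 : ∀ ω t, 1 ≤ t → t ≤ T → ∀ i, i < n →
        w ω t (i + 1) = w ω t i - (η t / (n : ℝ)) • m ω t (i + 1))
    (hwtn : ∀ ω t, 1 ≤ t → t ≤ T → wt ω t = w ω t n)
    (hmtn : ∀ ω t, 1 ≤ t → t ≤ T → mt ω t = v ω t n)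
    {ω ω' : Fin T → Equiv.Perm (Fin n)} {s : ℕ} (hs : s ≤ T)
    (hω : ∀ k : Fin T, k.val < s → ω k = ω' k) : wt ω s = wt ω' s ∧ mt ω s = mt ω' s := by
  induction s with
  | zero => simp [hwt0, hmt0]
  | succ s ih =>
    obtain ⟨ihw, ihm⟩ := ih (by omega) fun k hk => hω k (by omega)
    have h1 : 1 ≤ s + 1 := by omega
    have hm : m ω (s + 1) 0 = m ω' (s + 1) 0 := by
      rw [hm0 _ _ h1 hs, hm0 _ _ h1 hs]; exact ihm
    have hinner : ∀ i ≤ n, w ω (s + 1) i = w ω' (s + 1) i ∧ v ω (s + 1) i = v ω' (s + 1) i := by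
      intro i hi
      induction i with
      | zero =>
        rw [hw0 _ _ h1 hs, hw0 _ _ h1 hs, hv0 _ _ h1 hs, hv0 _ _ h1 hs]
        exact ⟨ihw, rfl⟩
      | succ i ihi =>
        obtain ⟨iw, iv⟩ := ihi (by omega)
        have hgi : g ω (s + 1) i = g ω' (s + 1) i := by
          rw [hg _ _ h1 hs i hi, hg _ _ h1 hs i hi, iw, hω _ (Nat.lt_succ_self s)]
        rw [hw1 _ _ h1 hs i hi, hw1 _ _ h1 hs i hi, hm1 _ _ h1 hs i hi, hm1 _ _ h1 hs i hi,
          hv1 _ _ h1 hs i hi, hv1 _ _ h1 hs i hi, iw, iv, hgi, hm]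
        exact ⟨rfl, rfl⟩
    rw [hwtn _ _ h1 hs, hwtn _ _ h1 hs, hmtn _ _ h1 hs, hmtn _ _ h1 hs]
    exact hinner n le_rfl

end Reshuffling

section StepSizes

theorem inv_add_one_le_log_sub_log {x : ℝ} (hx : 0 < x) :
    1 / (x + 1) ≤ Real.log (x + 1) - Real.log x := by
  have h1 := Real.log_le_sub_one_of_pos (div_pos hx (by linarith : 0 < x + 1))
  rw [Real.log_div hx.ne' (by linarith)] at h1
  have h2 : x / (x + 1) - 1 = -(1 / (x + 1)) := by field_simp; ring
  linarith

theorem sum_inv_add_le {lam : ℝ} (hlam : 0 ≤ lam) {T : ℕ} (hT : 2 ≤ T) :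
    ∑ t ∈ Icc 1 T, 1 / ((t : ℝ) + lam) ≤ 2 / (1 + lam) + Real.log ((T : ℝ) - 1 + lam) := by
  induction T, hT using Nat.le_induction with
  | base =>
    have h1 : 0 ≤ Real.log (1 + lam) := Real.log_nonneg (by linarith)
    have h2 : 1 / (2 + lam) ≤ 1 / (1 + lam) := by
      apply one_div_le_one_div_of_le <;> linarith
    have h3 : Icc 1 2 = ({1, 2} : Finset ℕ) := by decide
    rw [h3, sum_pair (by decide)]
    push_cast
    rw [show (2 : ℝ) - 1 + lam = 1 + lam by ring, show 2 / (1 + lam) = 1 / (1 + lam) +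
      1 / (1 + lam) by ring]
    linarith
  | succ T hT ih =>
    have hT' : (2 : ℝ) ≤ T := by exact_mod_cast hT
    rw [sum_Icc_succ_top (by omega)]
    push_cast
    have h1 := inv_add_one_le_log_sub_log (x := (T : ℝ) - 1 + lam) (by linarith)
    have h2 : 1 / ((T : ℝ) + 1 + lam) ≤ 1 / ((T : ℝ) - 1 + lam + 1) := by
      apply one_div_le_one_div_of_le <;> linarith
    rw [show (T : ℝ) - 1 + lam + 1 = T + 1 - 1 + lam by ring] at h1 h2
    linarith

theorem rpow_add_one_sub_rpow_le {x : ℝ} (hx : 0 < x) :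
    (x + 1) ^ ((2 : ℝ) / 3) - x ^ ((2 : ℝ) / 3) ≤ 1 / (x + 1) ^ ((1 : ℝ) / 3) := by
  have hsplit : ∀ y : ℝ, 0 < y → y ^ ((2 : ℝ) / 3) = y / y ^ ((1 : ℝ) / 3) := by
    intro y hy
    rw [show (2 : ℝ) / 3 = 1 - 1 / 3 by norm_num, Real.rpow_sub hy, Real.rpow_one]
  rw [hsplit x hx, hsplit _ (by linarith : 0 < x + 1)]
  have h1 : x / (x + 1) ^ ((1 : ℝ) / 3) ≤ x / x ^ ((1 : ℝ) / 3) := by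
    gcongr
    linarith
  rw [add_div]
  linarith

theorem rpow_sub_rpow_le_sum {lam : ℝ} (hlam : 0 ≤ lam) {T : ℕ} (hT : 1 ≤ T) :
    ((T : ℝ) + lam) ^ ((2 : ℝ) / 3) - (1 + lam) ^ ((2 : ℝ) / 3) ≤
      ∑ t ∈ Icc 1 T, 1 / ((t : ℝ) + lam) ^ ((1 : ℝ) / 3) := by
  induction T, hT using Nat.le_induction with
  | base =>
    simp only [Nat.cast_one, sub_self]
    positivity
  | succ T hT ih =>
    have hT' : (1 : ℝ) ≤ T := by exact_mod_cast hT
    rw [sum_Icc_succ_top (by omega)]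
    push_cast
    have h1 := rpow_add_one_sub_rpow_le (x := (T : ℝ) + lam) (by linarith)
    rw [show (T : ℝ) + lam + 1 = T + 1 + lam by ring] at h1
    linarith

theorem sq_mul_sq_le_of_le_one_div {L D η : ℝ} (hL : 0 < L) (hD : 0 < D) (hη : 0 ≤ η)
    (h : η ≤ 1 / (L * Real.sqrt D)) : D * (L ^ 2 * η ^ 2) ≤ 1 := by
  have hs := Real.sqrt_pos.2 hD
  rw [le_div_iff₀ (by positivity)] at h
  have h1 := pow_le_pow_left₀ (by positivity) h 2
  rw [mul_pow, mul_pow, Real.sq_sqrt hD.le] at h1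
  linarith

theorem sum_step_cube_le {γ lam : ℝ} (hγ : 0 < γ) (hlam : 0 ≤ lam) {n T : ℕ} (hT : 2 ≤ T)
    {η : ℕ → ℝ} (hη : ∀ t, 1 ≤ t →
      η t = γ * (n : ℝ) ^ ((1 : ℝ) / 3) / ((t : ℝ) + lam) ^ ((1 : ℝ) / 3)) :
    ∑ t ∈ Icc 1 T, η t ^ 3 ≤ γ ^ 3 * n * (2 / (1 + lam) + Real.log ((T : ℝ) - 1 + lam)) := by
  refine le_trans (le_of_eq ?_)
    (mul_le_mul_of_nonneg_left (sum_inv_add_le hlam hT) (by positivity))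
  rw [mul_sum]
  refine sum_congr rfl fun t ht => ?_
  have hcbrt : ∀ y : ℝ, 0 ≤ y → (y ^ ((1 : ℝ) / 3)) ^ 3 = y := fun y hy => by
    rw [← Real.rpow_natCast, ← Real.rpow_mul hy]; norm_num
  rw [hη t (mem_Icc.1 ht).1, div_pow, mul_pow, hcbrt _ (by positivity), hcbrt _ (by positivity)]
  ring

theorem le_sum_step {γ lam : ℝ} (hγ : 0 < γ) (hlam : 0 ≤ lam) {n T : ℕ} (hT : 1 ≤ T)
    {η : ℕ → ℝ} (hη : ∀ t, 1 ≤ t →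
      η t = γ * (n : ℝ) ^ ((1 : ℝ) / 3) / ((t : ℝ) + lam) ^ ((1 : ℝ) / 3)) :
    γ * (n : ℝ) ^ ((1 : ℝ) / 3) *
      (((T : ℝ) + lam) ^ ((2 : ℝ) / 3) - (1 + lam) ^ ((2 : ℝ) / 3)) ≤ ∑ t ∈ Icc 1 T, η t := by
  refine (mul_le_mul_of_nonneg_left (rpow_sub_rpow_le_sum hlam hT) (by positivity)).trans_eq ?_
  rw [mul_sum]
  exact sum_congr rfl fun t ht => by rw [hη t (mem_Icc.1 ht).1]; ring

end StepSizes

/-- Converts a bound on the weighted sum `S` into one on the weighted average `N⁻¹ * S / H`. -/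
theorem average_le_of_sum_le {N n β γ c Δ lam S H g₀ L σ l : ℝ} (hN : 0 < N) (hn : 0 < n)
    (hβ1 : β < 1) (hγ : 0 < γ) (hc : 0 < c) (hΔ : 0 < Δ) (hlam : 0 ≤ lam) (hS : 0 ≤ S)
    (hR : 0 ≤ 2 / (1 + lam) + l) (hH : γ * c * Δ ≤ H)
    (hmain : (1 - β) / 4 * S ≤ N * g₀ + N * (4 / 3 * (1 - β) * (L ^ 2 * σ ^ 2 / n) *
      (γ ^ 3 * n * (2 / (1 + lam) + l)))) :
    N⁻¹ * S / H ≤ ((4 * g₀ / ((1 - β) * γ) +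
        12 * σ ^ 2 * (5 - 3 * β) * L ^ 2 * γ ^ 2 / ((1 - β) * (1 + lam))) +
          6 * σ ^ 2 * (5 - 3 * β) * L ^ 2 * γ ^ 2 / (1 - β) * l) / (c * Δ) := by
  have hδ : 0 < 1 - β := sub_pos.2 hβ1
  set R := 2 / (1 + lam) + l with hRdef
  have hNS : N⁻¹ * S ≤ 4 * g₀ / (1 - β) +
      6 * σ ^ 2 * (5 - 3 * β) * L ^ 2 * γ ^ 3 / (1 - β) * R := by
    rw [inv_mul_le_iff₀ hN]
    have h1 : S ≤ N * (4 * g₀ / (1 - β) + 16 / 3 * (L ^ 2 * σ ^ 2 * γ ^ 3 * R)) := by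
      refine le_of_mul_le_mul_left (hmain.trans_eq ?_) (by positivity : 0 < (1 - β) / 4)
      field_simp
      ring
    refine h1.trans (mul_le_mul_of_nonneg_left ?_ hN.le)
    have h2 : 16 / 3 ≤ 6 * (5 - 3 * β) / (1 - β) := by
      rw [le_div_iff₀ hδ]; linarith
    have h3 := mul_le_mul_of_nonneg_right h2
      (by positivity : 0 ≤ L ^ 2 * σ ^ 2 * γ ^ 3 * R)
    have h4 : 6 * σ ^ 2 * (5 - 3 * β) * L ^ 2 * γ ^ 3 / (1 - β) * R =
        6 * (5 - 3 * β) / (1 - β) * (L ^ 2 * σ ^ 2 * γ ^ 3 * R) := by ring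
    linarith
  calc N⁻¹ * S / H ≤ N⁻¹ * S / (γ * c * Δ) :=
        div_le_div_of_nonneg_left (by positivity) (by positivity) hH
    _ ≤ (4 * g₀ / (1 - β) +
          6 * σ ^ 2 * (5 - 3 * β) * L ^ 2 * γ ^ 3 / (1 - β) * R) / (γ * c * Δ) := by gcongr
    _ = _ := by
        rw [hRdef]
        field_simp
        ring

theorem smg_rr_diminishing_lr
    (n d : ℕ) (hn : 1 ≤ n) (hd : 1 ≤ d)
    (f : Fin n → EuclideanSpace ℝ (Fin d) → ℝ)
    (hf : ∀ i, Differentiable ℝ (f i))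
    (F : EuclideanSpace ℝ (Fin d) → ℝ)
    (hF : F = fun x => (1 / (n : ℝ)) * ∑ i, f i x)
    (L : ℝ) (hL : 0 < L)
    (hsmooth : ∀ i x y, ‖gradient (f i) x - gradient (f i) y‖ ≤ L * ‖x - y‖)
    (Θ σ : ℝ) (hΘ : 0 ≤ Θ) (hσ : 0 ≤ σ)
    (hvar : ∀ x, (1 / (n : ℝ)) * ∑ i, ‖gradient (f i) x - gradient F x‖ ^ 2
        ≤ Θ * ‖gradient F x‖ ^ 2 + σ ^ 2)
    (Fstar : ℝ) (hFstar : IsGLB (Set.range F) Fstar)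
    (T : ℕ) (hT : 1 ≤ T)
    (β : ℝ) (hβ0 : 0 ≤ β) (hβ1 : β < 1)
    (η : ℕ → ℝ) (hηpos : ∀ t, 1 ≤ t → t ≤ T → 0 < η t)
    (w0 : EuclideanSpace ℝ (Fin d))
    (w m v g : (Fin T → Equiv.Perm (Fin n)) → ℕ → ℕ → EuclideanSpace ℝ (Fin d))
    (wt mt : (Fin T → Equiv.Perm (Fin n)) → ℕ → EuclideanSpace ℝ (Fin d))
    (hwt0 : ∀ ω, wt ω 0 = w0)
    (hmt0 : ∀ ω, mt ω 0 = 0)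
    (hw0 : ∀ ω t, 1 ≤ t → t ≤ T → w ω t 0 = wt ω (t - 1))
    (hm0 : ∀ ω t, 1 ≤ t → t ≤ T → m ω t 0 = mt ω (t - 1))
    (hv0 : ∀ ω t, 1 ≤ t → t ≤ T → v ω t 0 = 0)
    (hg : ∀ ω t, ∀ ht1 : 1 ≤ t, ∀ ht2 : t ≤ T, ∀ i, ∀ hi : i < n,
        g ω t i = gradient (f (ω ⟨t - 1, by omega⟩ ⟨i, hi⟩)) (w ω t i))
    (hm1 : ∀ ω t, 1 ≤ t → t ≤ T → ∀ i, i < n →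
        m ω t (i + 1) = β • m ω t 0 + (1 - β) • g ω t i)
    (hv1 : ∀ ω t, 1 ≤ t → t ≤ T → ∀ i, i < n →
        v ω t (i + 1) = v ω t i + ((n : ℝ))⁻¹ • g ω t i)
    (hw1 : ∀ ω t, 1 ≤ t → t ≤ T → ∀ i, i < n →
        w ω t (i + 1) = w ω t i - (η t / (n : ℝ)) • m ω t (i + 1))
    (hwtn : ∀ ω t, 1 ≤ t → t ≤ T → wt ω t = w ω t n)
    (hmtn : ∀ ω t, 1 ≤ t → t ≤ T → mt ω t = v ω t n)
    (D : ℝ)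
    (hDdef : D = max (5 / 3) (6 * (5 - 3 * β) * (Θ + (n : ℝ)) / ((n : ℝ) * (1 - β))))
    (γ lam : ℝ) (hγ : 0 < γ) (hlam : 0 ≤ lam)
    (hη0 : η 0 = η 1)
    (hη : ∀ t, 1 ≤ t → η t = γ * (n : ℝ) ^ ((1 : ℝ) / 3) / ((t : ℝ) + lam) ^ ((1 : ℝ) / 3))
    (hη1D : γ * (n : ℝ) ^ ((1 : ℝ) / 3) / ((1 : ℝ) + lam) ^ ((1 : ℝ) / 3)
        ≤ 1 / (L * Real.sqrt D))
    (hT2 : 2 ≤ T) :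
    (∑ t ∈ Icc 1 T, η t *
        ((Fintype.card (Fin T → Equiv.Perm (Fin n)) : ℝ)⁻¹ *
          ∑ ω : Fin T → Equiv.Perm (Fin n), ‖gradient F (wt ω (t - 1))‖ ^ 2))
      / (∑ t ∈ Icc 1 T, η t)
      ≤ ((4 * (F w0 - Fstar) / ((1 - β) * γ)
            + 12 * σ ^ 2 * (5 - 3 * β) * L ^ 2 * γ ^ 2 / ((1 - β) * (1 + lam)))
          + 6 * σ ^ 2 * (5 - 3 * β) * L ^ 2 * γ ^ 2 / (1 - β)
            * Real.log ((T : ℝ) - 1 + lam))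
        / ((n : ℝ) ^ ((1 : ℝ) / 3)
            * (((T : ℝ) + lam) ^ ((2 : ℝ) / 3) - ((1 : ℝ) + lam) ^ ((2 : ℝ) / 3))) := by
  have hn0 : (0 : ℝ) < n := by exact_mod_cast hn
  have hδ : 0 < 1 - β := sub_pos.2 hβ1
  set c := (n : ℝ) ^ ((1 : ℝ) / 3) with hc
  have hc0 : 0 < c := Real.rpow_pos_of_pos hn0 _
  have hηnn : ∀ t, 0 ≤ η t := by
    intro t
    rcases Nat.eq_zero_or_pos t with rfl | ht
    · rw [hη0]; exact (hηpos 1 le_rfl hT).le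
    · rw [hη t ht]; positivity
  have hηanti : ∀ t, 1 ≤ t → η t ≤ η (t - 1) := by
    intro t ht
    rcases Nat.lt_or_ge 1 t with h | h
    · rw [hη t ht, hη (t - 1) (by omega), Nat.cast_sub ht]
      have ht' : (1 : ℝ) < t := by exact_mod_cast h
      push_cast
      have : 0 < (t : ℝ) - 1 + lam := by linarith
      gcongr
      linarith
    · obtain rfl : t = 1 := by omega
      exact hη0.ge
  have hηone : ∀ t, 1 ≤ t → η t ≤ 1 / (L * Real.sqrt D) := by
    intro t ht
    refine le_trans ?_ hη1D
    rw [hη t ht]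
    have : (1 : ℝ) ≤ t := by exact_mod_cast ht
    gcongr
  have hD0 : 0 < D := by
    rw [hDdef]; exact lt_of_lt_of_le (by norm_num) (le_max_left _ _)
  have hstep_small : ∀ t, 1 ≤ t →
      6 * (5 - 3 * β) * (Θ + n) * (L ^ 2 * η t ^ 2) ≤ n * (1 - β) := by
    intro t ht
    have h1 := sq_mul_sq_le_of_le_one_div hL hD0 (hηnn t) (hηone t ht)
    have h2 : 6 * (5 - 3 * β) * (Θ + (n : ℝ)) / ((n : ℝ) * (1 - β)) ≤ D := by
      rw [hDdef]; exact le_max_right _ _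
    have h3 := (mul_le_mul_of_nonneg_right h2
      (by positivity : 0 ≤ L ^ 2 * η t ^ 2)).trans h1
    rwa [div_mul_eq_mul_div, div_le_one (by positivity)] at h3
  have hv : ∀ ω t, 1 ≤ t → t ≤ T → ∀ i ≤ n,
      v ω t i = (n : ℝ)⁻¹ • ∑ j ∈ range i, g ω t j := by
    intro ω t ht1 ht2 i hi
    induction i with
    | zero => simp [hv0 ω t ht1 ht2]
    | succ i ih => rw [hv1 ω t ht1 ht2 i hi, ih (by omega), sum_range_succ, smul_add]
  have hmean : ∀ x, ∑ a, (gradient (f a) x - gradient F x) = 0 := by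
    intro x
    rw [sum_sub_distrib, sum_const, card_univ, Fintype.card_fin, hF, gradient_average hf,
      ← Nat.cast_smul_eq_nsmul ℝ, smul_smul, mul_inv_cancel₀ hn0.ne', one_smul, sub_self]
  set N : ℝ := (Fintype.card (Fin T → Equiv.Perm (Fin n)) : ℝ) with hN
  have hN0 : 0 < N := by
    rw [hN]; exact_mod_cast Fintype.card_pos (α := Fin T → Equiv.Perm (Fin n))
  set Φ : ℕ → ℝ := fun t => ∑ ω : Fin T → Equiv.Perm (Fin n), ‖gradient F (wt ω (t - 1))‖ ^ 2
    with hΦ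
  have hΦ0 : ∀ t, 0 ≤ Φ t := fun t => by rw [hΦ]; positivity
  set U : ℕ → ℝ := fun t => ∑ ω : Fin T → Equiv.Perm (Fin n), (F (wt ω t) + η t *
    (β / 2 * ‖gradient F (wt ω t) - mt ω t‖ ^ 2 + (1 - β) / 18 * ‖mt ω t‖ ^ 2)) with hU
  have hepoch : ∀ t, 1 ≤ t → t ≤ T → U t ≤ U (t - 1) - (1 / 2 - (1 - β) / 4) * (η t * Φ t) +
      N * (4 / 3 * (1 - β) * (L ^ 2 * σ ^ 2 / n) * η t ^ 3) := by
    intro t ht1 ht2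
    have hsm := hstep_small t ht1
    set ε := L ^ 2 * η t ^ 2 with hεdef
    have hε0 : 0 ≤ ε := by positivity
    have hρ : 30 * ((Θ + n) * ε) ≤ n := by
      have h1 : 0 ≤ (Θ + n) * ε := by positivity
      have h2 : (1 - β) * (30 * ((Θ + n) * ε)) ≤ (1 - β) * n := by nlinarith
      exact le_of_mul_le_mul_left h2 hδ
    have hε30 : 30 * ε ≤ 1 := by
      refine le_of_mul_le_mul_left ?_ hn0
      nlinarith [mul_nonneg hΘ hε0]
    have hε12 : 12 * ε ≤ 1 - β := by
      refine le_of_mul_le_mul_left ?_ hn0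
      nlinarith [mul_nonneg hΘ hε0, mul_nonneg hn0.le hε0,
        mul_nonneg hδ.le (mul_nonneg hΘ hε0), mul_nonneg hδ.le (mul_nonneg hn0.le hε0)]
    set k : Fin T := ⟨t - 1, by omega⟩ with hk
    set Q : (Fin T → Equiv.Perm (Fin n)) → ℝ := fun ω => ∑ i ∈ range n, ‖∑ j with j.val < i,
      (gradient (f (ω k j)) (wt ω (t - 1)) - gradient F (wt ω (t - 1)))‖ ^ 2 with hQ
    have hpoint : ∀ ω, F (wt ω t) + η t *
        (β / 2 * ‖gradient F (wt ω t) - mt ω t‖ ^ 2 + (1 - β) / 18 * ‖mt ω t‖ ^ 2) ≤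
        (F (wt ω (t - 1)) + η (t - 1) *
          (β / 2 * ‖gradient F (wt ω (t - 1)) - mt ω (t - 1)‖ ^ 2 +
            (1 - β) / 18 * ‖mt ω (t - 1)‖ ^ 2)) +
        η t * (((1 - β) * (1 / 9 + 5 / 2 * ε) - 1 / 2) * ‖gradient F (wt ω (t - 1))‖ ^ 2) +
        η t * ((1 - β) * (4 * ε * ((n : ℝ) ^ 3)⁻¹)) * Q ω := by
      intro ω
      have h1 := epoch_potential_le hn hf hF hsmooth hβ0 hβ1.le (hηnn t) hε30 hε12 (ω k)
        (W := w ω t) (g := g ω t) (m₀ := mt ω (t - 1)) (hg ω t ht1 ht2)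
        (fun i hi => by rw [hw1 ω t ht1 ht2 i hi, hm1 ω t ht1 ht2 i hi, hm0 ω t ht1 ht2])
      rw [← hv ω t ht1 ht2 n le_rfl, ← hmtn ω t ht1 ht2, ← hwtn ω t ht1 ht2,
        hw0 ω t ht1 ht2, ← hεdef] at h1
      have h2 : η t * (β / 2 * ‖gradient F (wt ω (t - 1)) - mt ω (t - 1)‖ ^ 2 +
            (1 - β) / 18 * ‖mt ω (t - 1)‖ ^ 2) ≤ η (t - 1) *
          (β / 2 * ‖gradient F (wt ω (t - 1)) - mt ω (t - 1)‖ ^ 2 +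
            (1 - β) / 18 * ‖mt ω (t - 1)‖ ^ 2) :=
        mul_le_mul_of_nonneg_right (hηanti t ht1) (by positivity)
      have h3 : Q ω = ∑ i ∈ range n, ‖∑ j with j.val < i,
        (gradient (f (ω k j)) (wt ω (t - 1)) - gradient F (wt ω (t - 1)))‖ ^ 2 := rfl
      rw [← h3] at h1
      linarith
    have hQsum : ∑ ω, Q ω ≤ (n : ℝ) ^ 2 / 3 * (Θ * Φ t + N * σ ^ 2) := by
      have h1 := sum_pi_perm_prefix_le k (fun ω => wt ω (t - 1)) (fun ω τ =>
        (smg_iterates_congr (G := fun i => gradient (f i)) hwt0 hmt0 hw0 hm0 hv0 hg hm1 hv1 hw1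
          hwtn hmtn (by omega : t - 1 ≤ T) fun l hl => by
            have hlk : l ≠ k := by rintro rfl; simp [hk] at hl
            simp [Pi.mulSingle_eq_of_ne hlk]).1)
        (fun x a => gradient (f a) x - gradient F x) hmean
      refine h1.trans ?_
      have h2 : ∀ ω : Fin T → Equiv.Perm (Fin n), (n : ℝ) / 3 *
          ∑ a, ‖gradient (f a) (wt ω (t - 1)) - gradient F (wt ω (t - 1))‖ ^ 2 ≤
          (n : ℝ) ^ 2 / 3 * (Θ * ‖gradient F (wt ω (t - 1))‖ ^ 2 + σ ^ 2) := by
        intro ω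
        have h3 := mul_le_mul_of_nonneg_left (hvar (wt ω (t - 1)))
          (by positivity : 0 ≤ (n : ℝ) ^ 2 / 3)
        refine le_trans (le_of_eq ?_) h3
        field_simp
      refine (sum_le_sum fun ω _ => h2 ω).trans_eq ?_
      rw [← mul_sum, sum_add_distrib, ← mul_sum, sum_const, card_univ, nsmul_eq_mul]
    have hcoef : 0 ≤ η t * ((1 - β) * (4 * ε * ((n : ℝ) ^ 3)⁻¹)) := by
      have := hηnn t
      positivity
    have hfin := mul_le_mul_of_nonneg_left hQsum hcoef
    have hsplit : η t * ((1 - β) * (4 * ε * ((n : ℝ) ^ 3)⁻¹)) *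
        ((n : ℝ) ^ 2 / 3 * (Θ * Φ t + N * σ ^ 2)) =
        η t * ((1 - β) * (4 / 3 * (Θ * ε / n) * Φ t)) +
          N * (4 / 3 * (1 - β) * (L ^ 2 * σ ^ 2 / n) * η t ^ 3) := by
      rw [hεdef]; field_simp
    have hΘε : 5 / 2 * ε + 4 / 3 * (Θ * ε / n) ≤ 1 / 12 := by
      have h1 : (Θ + n) * ε / n ≤ 1 / 30 := by
        rw [div_le_iff₀ hn0]; linarith
      have h2 : (Θ + n) * ε / n = Θ * ε / n + ε := by field_simp
      have h3 : 0 ≤ Θ * ε / n := by positivity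
      linarith
    have hΦt : η t * ((1 - β) * ((5 / 2 * ε + 4 / 3 * (Θ * ε / n)) * Φ t)) ≤
        η t * ((1 - β) * (1 / 12 * Φ t)) :=
      mul_le_mul_of_nonneg_left (mul_le_mul_of_nonneg_left
        (mul_le_mul_of_nonneg_right hΘε (hΦ0 t)) hδ.le) (hηnn t)
    have hpos : 0 ≤ η t * ((1 - β) * Φ t) :=
      mul_nonneg (hηnn t) (mul_nonneg hδ.le (hΦ0 t))
    have hsum : U t ≤ U (t - 1) + η t * (((1 - β) * (1 / 9 + 5 / 2 * ε) - 1 / 2) * Φ t) +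
        η t * ((1 - β) * (4 * ε * ((n : ℝ) ^ 3)⁻¹)) * ∑ ω, Q ω := by
      refine (sum_le_sum fun ω _ => hpoint ω).trans_eq ?_
      rw [sum_add_distrib, sum_add_distrib, ← mul_sum, ← mul_sum, ← mul_sum]
    linarith
  have htele : ∀ s ≤ T, U s + (1 / 2 - (1 - β) / 4) * ∑ t ∈ Icc 1 s, η t * Φ t ≤
      U 0 + N * (4 / 3 * (1 - β) * (L ^ 2 * σ ^ 2 / n) * ∑ t ∈ Icc 1 s, η t ^ 3) := by
    intro s hs
    induction s with
    | zero => simp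
    | succ s ih =>
      have h1 := hepoch (s + 1) (by omega) hs
      rw [Nat.add_sub_cancel] at h1
      rw [sum_Icc_succ_top (by omega), sum_Icc_succ_top (by omega)]
      linarith [ih (by omega)]
  have hUT : N * Fstar ≤ U T := by
    rw [hN, ← nsmul_eq_mul, ← card_univ, ← sum_const]
    refine sum_le_sum fun ω _ => ?_
    have h1 : Fstar ≤ F (wt ω T) := hFstar.1 ⟨_, rfl⟩
    have h2 := hηnn T
    have h3 := hδ.le
    have h4 : 0 ≤ η T * (β / 2 * ‖gradient F (wt ω T) - mt ω T‖ ^ 2 +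
      (1 - β) / 18 * ‖mt ω T‖ ^ 2) := by positivity
    linarith
  have hU0 : U 0 = N * F w0 + β / 2 * (η 1 * Φ 1) := by
    simp only [hU, hΦ, hwt0, hmt0, hη0, sub_zero, norm_zero, Nat.sub_self, sum_const, card_univ,
      nsmul_eq_mul, ← hN]
    ring
  have hfirst : η 1 * Φ 1 ≤ ∑ t ∈ Icc 1 T, η t * Φ t :=
    single_le_sum (f := fun t => η t * Φ t) (fun t _ => mul_nonneg (hηnn t) (hΦ0 t))
      (mem_Icc.2 ⟨le_rfl, hT⟩)
  have hcube := sum_step_cube_le hγ hlam hT2 hη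
  set R := 2 / (1 + lam) + Real.log ((T : ℝ) - 1 + lam) with hR
  set S := ∑ t ∈ Icc 1 T, η t * Φ t with hS
  have hmain : (1 - β) / 4 * S ≤ N * (F w0 - Fstar) +
      N * (4 / 3 * (1 - β) * (L ^ 2 * σ ^ 2 / n) * (γ ^ 3 * n * R)) := by
    have h1 := htele T le_rfl
    have h2 : N * (4 / 3 * (1 - β) * (L ^ 2 * σ ^ 2 / n) * ∑ t ∈ Icc 1 T, η t ^ 3) ≤
        N * (4 / 3 * (1 - β) * (L ^ 2 * σ ^ 2 / n) * (γ ^ 3 * n * R)) := by gcongr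
    rw [hU0] at h1
    nlinarith [mul_le_mul_of_nonneg_left hfirst hβ0]
  have hR0 : 0 ≤ R := by
    have hT' : (2 : ℝ) ≤ T := by exact_mod_cast hT2
    have : 0 ≤ Real.log ((T : ℝ) - 1 + lam) := Real.log_nonneg (by linarith)
    positivity
  have hη_sum := le_sum_step hγ hlam hT hη
  have hΔ : 0 < ((T : ℝ) + lam) ^ ((2 : ℝ) / 3) - (1 + lam) ^ ((2 : ℝ) / 3) := by
    have hT' : (2 : ℝ) ≤ T := by exact_mod_cast hT2
    exact sub_pos.2 (Real.rpow_lt_rpow (by positivity) (by linarith) (by norm_num))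
  have hnum : ∑ t ∈ Icc 1 T, η t * (N⁻¹ * Φ t) = N⁻¹ * S := by
    rw [hS, mul_sum]
    exact sum_congr rfl fun t _ => by ring
  have hS0 : 0 ≤ S := sum_nonneg fun t _ => mul_nonneg (hηnn t) (hΦ0 t)
  rw [hnum]
  exact average_le_of_sum_le hN0 hn0 hβ1 hγ hc0 hΔ hlam hS0 hR0 hη_sum hmain
end

section
/- Under assumptions (a), (b) and the bounded gradient assumption, consider the SSMG iterates and suppose 0 < η_t ≤ 1/L for all t ∈ {1,…,T}. Then (1/Σ_{t=1}^T η_t) · Σ_{t=1}^T η_t·‖∇F(w̃_{t−1})‖² ≤ Δ_1/((Σ_{t=1}^T η_t)·(1−β^n)) + L²·G²·(Σ_{t=1}^T ξ_t³)/(Σ_{t=1}^T η_t) + 4·β^n·G²/(1−β^n), where ξ_1 := η_1, ξ_t := max(η_t, η_{t−1}) for t ≥ 2, and Δ_1 := 2·(F(w̃_0) − F_*) + (1/L + η_1)·‖∇F(w̃_0)‖² + 2·L·η_1²·G². -/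
open Finset

theorem norm_sub_le_of_step_le {E : Type*} [SeminormedAddCommGroup E] {n : ℕ} {u : ℕ → E}
    {δ : ℝ} (hδ : 0 ≤ δ) (hu : ∀ i < n, ‖u (i + 1) - u i‖ ≤ δ)
    {i j : ℕ} (hij : i ≤ j) (hj : j ≤ n) :
    ‖u j - u i‖ ≤ n * δ := by
  have h := dist_le_Ico_sum_of_dist_le (f := u) (d := fun _ => δ) hij fun {k} _ hk => by
    rw [dist_comm, dist_eq_norm]
    exact hu k (by omega)
  rw [sum_const, Nat.card_Ico, nsmul_eq_mul, dist_comm, dist_eq_norm] at h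
  refine h.trans ?_
  gcongr
  omega

section Helpers

variable {E : Type*} [NormedAddCommGroup E] [InnerProductSpace ℝ E]

/-- The descent lemma: the quadratic upper bound for a function with Lipschitz gradient. -/
theorem le_quadratic_of_lipschitz_gradient [CompleteSpace E] {F : E → ℝ} {L : ℝ}
    (hF : Differentiable ℝ F)
    (hL : ∀ x y, ‖gradient F x - gradient F y‖ ≤ L * ‖x - y‖) (x v : E) :
    F (x + v) ≤ F x + inner ℝ (gradient F x) v + L / 2 * ‖v‖ ^ 2 := by
  set φ : ℝ → ℝ := fun s => F (x + s • v) - s * inner ℝ (gradient F x) v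
    - L / 2 * ‖v‖ ^ 2 * s ^ 2 with hφ
  have hderiv : ∀ s, HasDerivAt φ (inner ℝ (gradient F (x + s • v)) v
      - inner ℝ (gradient F x) v - L * ‖v‖ ^ 2 * s) s := by
    intro s
    have hline : HasDerivAt (fun s : ℝ => x + s • v) v s := by
      simpa using ((hasDerivAt_id s).smul_const v).const_add x
    have hcomp := (hF (x + s • v)).hasGradientAt.hasFDerivAt.comp_hasDerivAt s hline
    have hlin := (hasDerivAt_id s).mul_const (inner ℝ (gradient F x) v)
    have hsq := ((hasDerivAt_id s).pow 2).const_mul (L / 2 * ‖v‖ ^ 2)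
    refine ((hcomp.sub hlin).sub hsq).congr_deriv ?_
    simp only [InnerProductSpace.toDual_apply_apply, id_eq]
    ring
  have hanti : AntitoneOn φ (Set.Icc 0 1) := by
    refine antitoneOn_of_deriv_nonpos (convex_Icc 0 1)
      (fun s _ => (hderiv s).continuousAt.continuousWithinAt)
      (fun s _ => (hderiv s).differentiableAt.differentiableWithinAt) fun s hs => ?_
    rw [interior_Icc] at hs
    rw [(hderiv s).deriv, ← inner_sub_left]
    have hgrad := hL (x + s • v) x
    rw [add_sub_cancel_left, norm_smul, Real.norm_of_nonneg hs.1.le] at hgrad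
    have hinner := real_inner_le_norm (gradient F (x + s • v) - gradient F x) v
    nlinarith [mul_le_mul_of_nonneg_right hgrad (norm_nonneg v)]
  have h01 := hanti (by simp) (by simp) (zero_le_one' ℝ)
  simp only [hφ, one_smul, zero_smul, add_zero] at h01
  linarith

theorem hasGradientAt_mean [CompleteSpace E] {n : ℕ} {f : Fin n → E → ℝ}
    (hf : ∀ i, Differentiable ℝ (f i)) (x : E) :
    HasGradientAt (fun y => (1 / (n : ℝ)) * ∑ i, f i y)
      ((1 / (n : ℝ)) • ∑ i, gradient (f i) x) x := by
  rw [hasGradientAt_iff_hasFDerivAt, map_smulₛₗ, map_sum]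
  exact (HasFDerivAt.fun_sum fun i _ => (hf i x).hasGradientAt.hasFDerivAt).const_mul _

theorem norm_mean_le {n : ℕ} (hn : 1 ≤ n) {v : Fin n → E} {C : ℝ} (hv : ∀ i, ‖v i‖ ≤ C) :
    ‖(1 / (n : ℝ)) • ∑ i, v i‖ ≤ C := by
  have hn' : (0 : ℝ) < n := by exact_mod_cast hn
  have hsum := norm_sum_le_of_le univ fun i _ => hv i
  rw [norm_smul, Real.norm_of_nonneg (by positivity), one_div, inv_mul_le_iff₀ hn']
  simpa using hsum

theorem sq_norm_mean_le {n : ℕ} (hn : 1 ≤ n) {v : Fin n → E} {C : ℝ}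
    (hv : ∀ i, ‖v i‖ ^ 2 ≤ C) : ‖(1 / (n : ℝ)) • ∑ i, v i‖ ^ 2 ≤ C := by
  have hC : 0 ≤ C := (sq_nonneg _).trans (hv ⟨0, hn⟩)
  exact (Real.le_sqrt (norm_nonneg _) hC).1
    (norm_mean_le hn fun i => (Real.le_sqrt (norm_nonneg _) hC).2 (hv i))

theorem norm_convex_comb_le {β C D : ℝ} (hβ0 : 0 ≤ β) (hβ1 : β ≤ 1) {x y : E}
    (hx : ‖x‖ ≤ C) (hy : ‖y‖ ≤ D) : ‖β • x + (1 - β) • y‖ ≤ β * C + (1 - β) * D := by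
  have h1 : 0 ≤ 1 - β := by linarith
  refine (norm_add_le _ _).trans ?_
  rw [norm_smul, norm_smul, Real.norm_of_nonneg hβ0, Real.norm_of_nonneg h1]
  gcongr

theorem sq_norm_convex_comb_le {β : ℝ} (hβ0 : 0 ≤ β) (hβ1 : β ≤ 1) (x y : E) :
    ‖β • x + (1 - β) • y‖ ^ 2 ≤ β * ‖x‖ ^ 2 + (1 - β) * ‖y‖ ^ 2 := by
  have h := norm_convex_comb_le hβ0 hβ1 (le_refl ‖x‖) (le_refl ‖y‖)
  have h2 := pow_le_pow_left₀ (norm_nonneg _) h 2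
  nlinarith [mul_nonneg (mul_nonneg hβ0 (sub_nonneg.2 hβ1)) (sq_nonneg (‖x‖ - ‖y‖))]

/-- Exponential averages of a periodic sequence have a periodic orbit, whose mean over a period is
the mean of the sequence. -/
theorem exists_periodic_exponential_average {n : ℕ} (hn : 1 ≤ n) {β C : ℝ} (hβ0 : 0 ≤ β)
    (hβ1 : β < 1) {h : ℕ → E} (hh : ∀ i < n, ‖h i‖ ≤ C) :
    ∃ p : ℕ → E, (∀ i, p (i + 1) = β • p i + (1 - β) • h i) ∧ p n = p 0 ∧ ‖p 0‖ ≤ C ∧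
      ∑ i ∈ range n, p (i + 1) = ∑ i ∈ range n, h i := by
  let q : ℕ → E := fun k => Nat.rec 0 (fun i x => β • x + (1 - β) • h i) k
  have hqs : ∀ i, q (i + 1) = β • q i + (1 - β) • h i := fun i => rfl
  have hqn : ∀ i ≤ n, ‖q i‖ ≤ (1 - β ^ i) * C := by
    intro i
    induction i with
    | zero => intro _; simp [q]
    | succ k ih =>
      intro hk
      rw [hqs]
      refine (norm_convex_comb_le hβ0 hβ1.le (ih (by omega)) (hh k (by omega))).trans_eq ?_
      ring
  have hβn : 0 < 1 - β ^ n := sub_pos.2 (pow_lt_one₀ hβ0 hβ1 (by omega))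
  set c : E := (1 - β ^ n)⁻¹ • q n with hc
  have hrec : ∀ i, q (i + 1) + β ^ (i + 1) • c = β • (q i + β ^ i • c) + (1 - β) • h i := by
    intro i
    rw [hqs]
    module
  have hper : q n + β ^ n • c = q 0 + β ^ 0 • c := by
    have hqc : q n = (1 - β ^ n) • c := by rw [hc, smul_inv_smul₀ hβn.ne']
    have hq0 : q 0 = 0 := rfl
    rw [hqc, hq0]
    module
  refine ⟨fun i => q i + β ^ i • c, hrec, hper, ?_, ?_⟩
  · have hq0 : q 0 = 0 := rfl
    simp only [hq0, pow_zero, one_smul, zero_add]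
    rw [hc, norm_smul, norm_inv, Real.norm_of_nonneg hβn.le, inv_mul_le_iff₀ hβn]
    exact hqn n le_rfl
  · set p : ℕ → E := fun i => q i + β ^ i • c with hp
    have hshift : ∑ i ∈ range n, p (i + 1) = ∑ i ∈ range n, p i := by
      have h1 := sum_range_succ p n
      rw [sum_range_succ', show p n = p 0 from hper] at h1
      exact add_right_cancel h1
    have hsum : ∑ i ∈ range n, p (i + 1)
        = β • ∑ i ∈ range n, p (i + 1) + (1 - β) • ∑ i ∈ range n, h i := by
      nth_rewrite 2 [hshift]
      rw [smul_sum, smul_sum, ← sum_add_distrib]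
      exact sum_congr rfl fun i _ => hrec i
    have h1 : (1 - β) • ∑ i ∈ range n, p (i + 1) = (1 - β) • ∑ i ∈ range n, h i := by
      rw [sub_smul, one_smul, sub_eq_iff_eq_add']
      exact hsum
    exact smul_right_injective E (sub_ne_zero.2 hβ1.ne') h1

theorem sq_norm_exponential_average_le {n : ℕ} {β A c : ℝ} (hβ0 : 0 ≤ β) (hβ1 : β ≤ 1)
    {e r : ℕ → E} (he : ∀ i < n, e (i + 1) = β • e i + (1 - β) • r i)
    (hr : ∀ i < n, ‖r i‖ ≤ c) (he0 : ‖e 0‖ ^ 2 ≤ A + c ^ 2) :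
    ∀ i ≤ n, ‖e i‖ ^ 2 ≤ β ^ i * A + c ^ 2 := by
  intro i
  induction i with
  | zero => intro _; simpa using he0
  | succ k ih =>
    intro hk
    have hrk := pow_le_pow_left₀ (norm_nonneg _) (hr k (by omega)) 2
    rw [he k (by omega)]
    calc _ ≤ β * ‖e k‖ ^ 2 + (1 - β) * ‖r k‖ ^ 2 := sq_norm_convex_comb_le hβ0 hβ1 _ _
      _ ≤ β * (β ^ k * A + c ^ 2) + (1 - β) * c ^ 2 := by
        have h1 : 0 ≤ 1 - β := by linarith
        gcongr
        exact ih (by omega)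
      _ = _ := by ring

/-- Two consecutive epochs of exponential averaging of gradients that stay within `c` of
the values `h` leave an average direction close to the mean of `h`. -/
theorem sq_norm_mean_sub_mean_average_le {n : ℕ} (hn : 1 ≤ n) {β C c : ℝ} (hβ0 : 0 ≤ β)
    (hβ1 : β < 1) {h g₁ g₂ m₁ m₂ : ℕ → E} (hh : ∀ i < n, ‖h i‖ ≤ C)
    (hm₁ : ∀ i < n, m₁ (i + 1) = β • m₁ i + (1 - β) • g₁ i)
    (hm₂ : ∀ i < n, m₂ (i + 1) = β • m₂ i + (1 - β) • g₂ i)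
    (hm₀ : ‖m₁ 0‖ ≤ C) (hm : m₂ 0 = m₁ n)
    (hg₁ : ∀ i < n, ‖h i - g₁ i‖ ≤ c) (hg₂ : ∀ i < n, ‖h i - g₂ i‖ ≤ c) :
    ‖(1 / (n : ℝ)) • ∑ i ∈ range n, h i - (1 / (n : ℝ)) • ∑ i ∈ range n, m₂ (i + 1)‖ ^ 2
      ≤ 4 * β ^ n * C ^ 2 + c ^ 2 := by
  obtain ⟨p, hp, hpn, hp0, hps⟩ := exists_periodic_exponential_average hn hβ0 hβ1 hh
  have hA : (0 : ℝ) ≤ β ^ n * (4 * C ^ 2) := by positivity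
  have herr₁ := sq_norm_exponential_average_le (e := fun i => p i - m₁ i)
    (A := 4 * C ^ 2) hβ0 hβ1.le
    (fun i hi => by rw [hp, hm₁ i hi]; module) hg₁ (by
      have h1 : ‖p 0 - m₁ 0‖ ≤ 2 * C := (norm_sub_le _ _).trans (by linarith)
      have h2 := pow_le_pow_left₀ (norm_nonneg _) h1 2
      nlinarith [sq_nonneg c]) n le_rfl
  have herr₂ := sq_norm_exponential_average_le (e := fun i => p i - m₂ i)
    (A := β ^ n * (4 * C ^ 2)) hβ0 hβ1.le
    (fun i hi => by rw [hp, hm₂ i hi]; module) hg₂ (by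
      simpa only [hm, hpn] using herr₁)
  rw [← smul_sub, ← hps, ← sum_sub_distrib, sum_range]
  refine sq_norm_mean_le hn fun i => (herr₂ (i + 1) i.2).trans ?_
  have h1 : β ^ ((i : ℕ) + 1) * (β ^ n * (4 * C ^ 2)) ≤ β ^ n * (4 * C ^ 2) :=
    mul_le_of_le_one_left hA (pow_le_one₀ hβ0 hβ1.le)
  linarith

end Helpers

theorem ssmg_theorem
    (n d : ℕ) (hn : 1 ≤ n) (hd : 1 ≤ d)
    (f : Fin n → EuclideanSpace ℝ (Fin d) → ℝ)
    (hf : ∀ i, Differentiable ℝ (f i))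
    (F : EuclideanSpace ℝ (Fin d) → ℝ)
    (hF : F = fun x => (1 / (n : ℝ)) * ∑ i, f i x)
    (L : ℝ) (hL : 0 < L)
    (hsmooth : ∀ i x y, ‖gradient (f i) x - gradient (f i) y‖ ≤ L * ‖x - y‖)
    (Fstar : ℝ) (hFstar : IsGLB (Set.range F) Fstar)
    (G : ℝ) (hG : 0 < G)
    (hbg : ∀ i x, ‖gradient (f i) x‖ ≤ G)
    (T : ℕ) (hT : 1 ≤ T)
    (β : ℝ) (hβ0 : 0 ≤ β) (hβ1 : β < 1)
    (η : ℕ → ℝ) (hηpos : ∀ t, 1 ≤ t → t ≤ T → 0 < η t)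
    (π : Equiv.Perm (Fin n))
    (w m g : ℕ → ℕ → EuclideanSpace ℝ (Fin d))
    (wt mt : ℕ → EuclideanSpace ℝ (Fin d))
    (hmt0 : mt 0 = 0)
    (hw0 : ∀ t, 1 ≤ t → t ≤ T → w t 0 = wt (t - 1))
    (hm0 : ∀ t, 1 ≤ t → t ≤ T → m t 0 = mt (t - 1))
    (hg : ∀ t, 1 ≤ t → t ≤ T → ∀ i, ∀ hi : i < n,
        g t i = gradient (f (π ⟨i, hi⟩)) (w t i))
    (hm1 : ∀ t, 1 ≤ t → t ≤ T → ∀ i, i < n →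
        m t (i + 1) = β • m t i + (1 - β) • g t i)
    (hw1 : ∀ t, 1 ≤ t → t ≤ T → ∀ i, i < n →
        w t (i + 1) = w t i - (η t / (n : ℝ)) • m t (i + 1))
    (hwt : ∀ t, 1 ≤ t → t ≤ T → wt t = w t n)
    (hmt : ∀ t, 1 ≤ t → t ≤ T → mt t = m t n)
    (ξ : ℕ → ℝ) (hξ1 : ξ 1 = η 1) (hξ : ∀ t, 2 ≤ t → ξ t = max (η t) (η (t - 1)))
    (hηL : ∀ t, 1 ≤ t → t ≤ T → η t ≤ 1 / L) :
    (∑ t ∈ Icc 1 T, η t * ‖gradient F (wt (t - 1))‖ ^ 2) / (∑ t ∈ Icc 1 T, η t)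
      ≤ (2 * (F (wt 0) - Fstar) + (1 / L + η 1) * ‖gradient F (wt 0)‖ ^ 2
            + 2 * L * η 1 ^ 2 * G ^ 2)
          / ((∑ t ∈ Icc 1 T, η t) * (1 - β ^ n))
        + L ^ 2 * G ^ 2 * ((∑ t ∈ Icc 1 T, ξ t ^ 3) / (∑ t ∈ Icc 1 T, η t))
        + 4 * β ^ n * G ^ 2 / (1 - β ^ n) := by
  have hn' : (0 : ℝ) < n := by exact_mod_cast hn
  have hgradF : ∀ x, gradient F x = (1 / (n : ℝ)) • ∑ i, gradient (f i) x := by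
    intro x
    rw [hF]
    exact (hasGradientAt_mean hf x).gradient
  have hFdiff : Differentiable ℝ F := by
    intro x
    rw [hF]
    exact (hasGradientAt_mean hf x).differentiableAt
  have hFsmooth : ∀ x y, ‖gradient F x - gradient F y‖ ≤ L * ‖x - y‖ := by
    intro x y
    rw [hgradF, hgradF, ← smul_sub, ← sum_sub_distrib]
    exact norm_mean_le hn fun i => hsmooth i x y
  have hm_epoch : ∀ t, 1 ≤ t → t ≤ T → ‖m t 0‖ ≤ G → ∀ i ≤ n, ‖m t i‖ ≤ G := by
    intro t h1 h2 h0 i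
    induction i with
    | zero => intro _; exact h0
    | succ k ih =>
      intro hk
      rw [hm1 t h1 h2 k hk, hg t h1 h2 k hk]
      refine (norm_convex_comb_le hβ0 hβ1.le (ih (by omega)) (hbg _ _)).trans_eq ?_
      ring
  have hmt_le : ∀ t ≤ T, ‖mt t‖ ≤ G := by
    intro t
    induction t with
    | zero => intro _; simpa [hmt0] using hG.le
    | succ k ih =>
      intro hk
      rw [hmt (k + 1) (by omega) hk]
      refine hm_epoch (k + 1) (by omega) hk ?_ n le_rfl
      rw [hm0 (k + 1) (by omega) hk]
      exact ih (by omega)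
  have hm_le : ∀ t, 1 ≤ t → t ≤ T → ∀ i ≤ n, ‖m t i‖ ≤ G := by
    intro t h1 h2
    refine hm_epoch t h1 h2 ?_
    rw [hm0 t h1 h2]
    exact hmt_le _ (by omega)
  have hdrift : ∀ t, 1 ≤ t → t ≤ T → ∀ i j, i ≤ j → j ≤ n →
      ‖w t j - w t i‖ ≤ η t * G := by
    intro t h1 h2 i j hij hj
    have hη := hηpos t h1 h2
    have h := norm_sub_le_of_step_le (u := w t) (δ := η t / n * G) (by positivity)
      (fun k hk => by
        rw [hw1 t h1 h2 k hk, sub_sub_cancel_left, norm_neg, norm_smul,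
          Real.norm_of_nonneg (by positivity)]
        gcongr
        exact hm_le t h1 h2 _ hk) hij hj
    refine h.trans_eq ?_
    field_simp
  set M : ℕ → EuclideanSpace ℝ (Fin d) :=
    fun t => (1 / (n : ℝ)) • ∑ i ∈ range n, m t (i + 1) with hM
  have hM_le : ∀ t, 1 ≤ t → t ≤ T → ‖M t‖ ≤ G := by
    intro t h1 h2
    rw [hM]
    simp only [sum_range]
    exact norm_mean_le hn fun i => hm_le t h1 h2 _ i.2
  have hstep : ∀ t, 1 ≤ t → t ≤ T → wt t = wt (t - 1) + -(η t • M t) := by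
    intro t h1 h2
    have htel := sum_range_sub (w t) n
    rw [sum_congr rfl fun i hi => show w t (i + 1) - w t i = -(η t / (n : ℝ)) • m t (i + 1) by
      rw [hw1 t h1 h2 i (mem_range.1 hi)]; module, ← smul_sum] at htel
    rw [hwt t h1 h2, ← hw0 t h1 h2, ← sub_eq_iff_eq_add', ← htel, hM]
    simp only [smul_smul, ← neg_smul]
    congr 1
    ring
  have hdescent : ∀ t, 1 ≤ t → t ≤ T → F (wt t) ≤ F (wt (t - 1))
      - η t * inner ℝ (gradient F (wt (t - 1))) (M t) + L / 2 * η t ^ 2 * ‖M t‖ ^ 2 := by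
    intro t h1 h2
    have h := le_quadratic_of_lipschitz_gradient hFdiff hFsmooth (wt (t - 1)) (-(η t • M t))
    rw [← hstep t h1 h2, inner_neg_right, inner_smul_right, norm_neg, norm_smul, mul_pow,
      Real.norm_eq_abs, sq_abs] at h
    linarith
  have hfirst : η 1 * ‖gradient F (wt 0)‖ ^ 2 + 2 * F (wt 1) ≤ 2 * F (wt 0)
      + (1 / L + η 1) * ‖gradient F (wt 0)‖ ^ 2 + 2 * L * η 1 ^ 2 * G ^ 2 := by
    have hη := hηpos 1 le_rfl hT
    have hd1 := hdescent 1 le_rfl hT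
    rw [Nat.sub_self] at hd1
    have hinner := (abs_le.1 (abs_real_inner_le_norm (gradient F (wt 0)) (M 1))).1
    have hMsq := pow_le_pow_left₀ (norm_nonneg _) (hM_le 1 le_rfl hT) 2
    have hyoung : 2 * (η 1 * (‖gradient F (wt 0)‖ * ‖M 1‖))
        ≤ 1 / L * ‖gradient F (wt 0)‖ ^ 2 + L * η 1 ^ 2 * ‖M 1‖ ^ 2 := by
      have h : 0 ≤ 1 / L * (‖gradient F (wt 0)‖ - L * η 1 * ‖M 1‖) ^ 2 := by positivity
      have h' : 1 / L * (‖gradient F (wt 0)‖ - L * η 1 * ‖M 1‖) ^ 2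
          = 1 / L * ‖gradient F (wt 0)‖ ^ 2 + L * η 1 ^ 2 * ‖M 1‖ ^ 2
            - 2 * (η 1 * (‖gradient F (wt 0)‖ * ‖M 1‖)) := by
        field_simp
        ring
      linarith
    have hLη : 0 ≤ 2 * L * η 1 ^ 2 := by positivity
    linarith [mul_le_mul_of_nonneg_left hinner hη.le, mul_le_mul_of_nonneg_left hMsq hLη]
  have hlater : ∀ t, 1 ≤ t → t + 1 ≤ T →
      η (t + 1) * ‖gradient F (wt t)‖ ^ 2 + 2 * F (wt (t + 1)) ≤ 2 * F (wt t)
        + (4 * β ^ n * G ^ 2 * η (t + 1) + L ^ 2 * G ^ 2 * ξ (t + 1) ^ 3) := by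
    intro t h1 h2
    have hη := hηpos (t + 1) (by omega) h2
    have hηL' : L * η (t + 1) ≤ 1 := by
      have := hηL (t + 1) (by omega) h2
      rwa [le_div_iff₀ hL, mul_comm] at this
    have hξt := hξ (t + 1) (by omega)
    rw [Nat.add_sub_cancel] at hξt
    have hξη : η (t + 1) ≤ ξ (t + 1) := hξt ▸ le_max_left _ _
    have hξη' : η t ≤ ξ (t + 1) := hξt ▸ le_max_right _ _
    have hd1 := hdescent (t + 1) (by omega) h2
    rw [Nat.add_sub_cancel] at hd1
    let h : ℕ → EuclideanSpace ℝ (Fin d) :=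
      fun i => if hi : i < n then gradient (f (π ⟨i, hi⟩)) (wt t) else 0
    have hh : ∀ i (hi : i < n), h i = gradient (f (π ⟨i, hi⟩)) (wt t) := fun i hi => dif_pos hi
    have hmean : gradient F (wt t) = (1 / (n : ℝ)) • ∑ i ∈ range n, h i := by
      rw [hgradF, sum_range, ← Equiv.sum_comp π]
      congr 1
      exact sum_congr rfl fun i _ => (hh i i.2).symm
    have herr := sq_norm_mean_sub_mean_average_le (C := G) (c := L * (ξ (t + 1) * G)) hn hβ0 hβ1
      (h := h) (g₁ := g t) (g₂ := g (t + 1)) (m₁ := m t) (m₂ := m (t + 1))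
      (fun i hi => by rw [hh i hi]; exact hbg _ _)
      (hm1 t h1 (by omega)) (hm1 (t + 1) (by omega) h2)
      (hm_le t h1 (by omega) 0 (by omega))
      (by rw [hm0 (t + 1) (by omega) h2, Nat.add_sub_cancel, hmt t h1 (by omega)])
      (fun i hi => by
        rw [hh i hi, hg t h1 (by omega) i hi, hwt t h1 (by omega)]
        refine (hsmooth _ _ _).trans ?_
        gcongr
        refine (hdrift t h1 (by omega) i n hi.le le_rfl).trans ?_
        gcongr)
      (fun i hi => by
        rw [hh i hi, hg (t + 1) (by omega) h2 i hi,
          show wt t = w (t + 1) 0 by rw [hw0 (t + 1) (by omega) h2, Nat.add_sub_cancel]]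
        refine (hsmooth _ _ _).trans ?_
        gcongr
        rw [norm_sub_rev]
        refine (hdrift (t + 1) (by omega) h2 0 i (by omega) hi.le).trans ?_
        gcongr)
    rw [← hmean] at herr
    change ‖gradient F (wt t) - M (t + 1)‖ ^ 2 ≤ _ at herr
    rw [norm_sub_sq_real] at herr
    have hcube : η (t + 1) * (L * (ξ (t + 1) * G)) ^ 2 ≤ L ^ 2 * G ^ 2 * ξ (t + 1) ^ 3 := by
      have h : 0 ≤ (L * (ξ (t + 1) * G)) ^ 2 := by positivity
      linarith [mul_le_mul_of_nonneg_right hξη h]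
    have hquad : η (t + 1) * (L * η (t + 1) * ‖M (t + 1)‖ ^ 2)
        ≤ η (t + 1) * ‖M (t + 1)‖ ^ 2 :=
      mul_le_mul_of_nonneg_left (mul_le_of_le_one_left (sq_nonneg _) hηL') hη.le
    linarith [mul_le_mul_of_nonneg_left herr hη.le]
  have hξ1' : 0 < ξ 1 := hξ1 ▸ hηpos 1 le_rfl hT
  have htotal : ∀ t, 1 ≤ t → t ≤ T →
      ∑ s ∈ Icc 1 t, η s * ‖gradient F (wt (s - 1))‖ ^ 2 + 2 * F (wt t) ≤ 2 * F (wt 0)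
        + (1 / L + η 1) * ‖gradient F (wt 0)‖ ^ 2 + 2 * L * η 1 ^ 2 * G ^ 2
        + ∑ s ∈ Icc 1 t, (4 * β ^ n * G ^ 2 * η s + L ^ 2 * G ^ 2 * ξ s ^ 3) := by
    intro t h1
    induction t, h1 using Nat.le_induction with
    | base =>
      intro _
      have hη := hηpos 1 le_rfl hT
      have h : 0 ≤ 4 * β ^ n * G ^ 2 * η 1 + L ^ 2 * G ^ 2 * ξ 1 ^ 3 := by positivity
      simp only [Icc_self, sum_singleton, Nat.sub_self]
      linarith
    | succ t h1 ih =>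
      intro h2
      rw [sum_Icc_succ_top (by omega), sum_Icc_succ_top (by omega), Nat.add_sub_cancel]
      linarith [ih (by omega), hlater t h1 h2]
  have hfinal := htotal T hT le_rfl
  have hlow : Fstar ≤ F (wt T) := hFstar.1 (Set.mem_range_self _)
  have hlow0 : Fstar ≤ F (wt 0) := hFstar.1 (Set.mem_range_self _)
  rw [sum_add_distrib, ← mul_sum, ← mul_sum] at hfinal
  have hS : 0 < ∑ t ∈ Icc 1 T, η t :=
    sum_pos (fun t ht => hηpos t (mem_Icc.1 ht).1 (mem_Icc.1 ht).2) ⟨1, by simp [hT]⟩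
  have hβn : 0 < 1 - β ^ n := sub_pos.2 (pow_lt_one₀ hβ0 hβ1 (by omega))
  have hβn' : 1 - β ^ n ≤ 1 := sub_le_self _ (by positivity)
  set S := ∑ t ∈ Icc 1 T, η t with hSdef
  set X := ∑ t ∈ Icc 1 T, ξ t ^ 3 with hX
  set Δ := 2 * (F (wt 0) - Fstar) + (1 / L + η 1) * ‖gradient F (wt 0)‖ ^ 2
    + 2 * L * η 1 ^ 2 * G ^ 2 with hΔ
  have hΔ0 : 0 ≤ Δ := by
    have hη := hηpos 1 le_rfl hT
    have h0 : 0 ≤ F (wt 0) - Fstar := sub_nonneg.2 hlow0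
    positivity
  calc (∑ t ∈ Icc 1 T, η t * ‖gradient F (wt (t - 1))‖ ^ 2) / S
      ≤ (Δ + (4 * β ^ n * G ^ 2 * S + L ^ 2 * G ^ 2 * X)) / S := by
        gcongr
        linarith
    _ = Δ / S + L ^ 2 * G ^ 2 * (X / S) + 4 * β ^ n * G ^ 2 := by
        field_simp
        ring
    _ ≤ _ := by
        gcongr
        · exact mul_le_of_le_one_right hS.le hβn'
        · exact le_div_self (by positivity) hβn hβn'
end

section
/- Under the bounded gradient assumption and L-smoothness of each f(·;i), the SSMG iterates satisfy, for every t ∈ {2,…,T} and every i ∈ {0,…,n−1}: ‖g_i^(t) − ∇f(w_0^(t); π(i+1))‖² ≤ L²·G²·ξ_t² and ‖g_i^(t−1) − ∇f(w_0^(t); π(i+1))‖² ≤ L²·G²·ξ_t², where ξ_t := max(η_t, η_{t−1}). -/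
open Finset

/-- An exponential moving average of vectors of norm at most `G`, started from such a vector,
has norm at most `G`. -/
theorem norm_movingAverage_le {E : Type*} [NormedAddCommGroup E] [NormedSpace ℝ E]
    {n : ℕ} {β G : ℝ} (hβ0 : 0 ≤ β) (hβ1 : β ≤ 1) {m g : ℕ → E}
    (hm0 : ‖m 0‖ ≤ G) (hg : ∀ i, i < n → ‖g i‖ ≤ G)
    (hm : ∀ i, i < n → m (i + 1) = β • m i + (1 - β) • g i) :
    ∀ i, i ≤ n → ‖m i‖ ≤ G := by
  intro i
  induction i with
  | zero => exact fun _ => hm0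
  | succ i ih =>
    intro hi
    have hmem := convex_closedBall (0 : E) G
      (mem_closedBall_zero_iff.2 (ih (by omega))) (mem_closedBall_zero_iff.2 (hg i hi))
      hβ0 (sub_nonneg.2 hβ1) (add_sub_cancel β 1)
    rw [hm i hi]
    exact mem_closedBall_zero_iff.1 hmem

/-- Any `k ≤ n` consecutive steps of size `η / n` along directions of norm at most `G`
move the iterate by at most `η * G`. -/
theorem norm_sub_le_of_steps {E : Type*} [NormedAddCommGroup E] [NormedSpace ℝ E]
    {n : ℕ} {η G : ℝ} (hη : 0 ≤ η) (hG : 0 ≤ G) {w m : ℕ → E}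
    (hm : ∀ i, i ≤ n → ‖m i‖ ≤ G)
    (hw : ∀ i, i < n → w (i + 1) = w i - (η / (n : ℝ)) • m (i + 1))
    {i j : ℕ} (hij : i ≤ j) (hj : j ≤ n) :
    ‖w i - w j‖ ≤ η * G := by
  have hsum : dist (w i) (w j) ≤ ∑ _k ∈ Ico i j, η / n * G := by
    refine dist_le_Ico_sum_of_dist_le hij fun {k} _ hk => ?_
    rw [hw k (by omega), dist_eq_norm, sub_sub_cancel, norm_smul,
      Real.norm_of_nonneg (by positivity)]
    exact mul_le_mul_of_nonneg_left (hm _ (by omega)) (by positivity)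
  rw [dist_eq_norm, sum_const, Nat.card_Ico, nsmul_eq_mul] at hsum
  rcases Nat.eq_zero_or_pos n with rfl | hn
  · exact hsum.trans (by simp; positivity)
  · have hn' : (0 : ℝ) < n := by exact_mod_cast hn
    calc ‖w i - w j‖ ≤ ((j - i : ℕ) : ℝ) * (η / n * G) := hsum
      _ ≤ n * (η / n * G) := by
        gcongr
        omega
      _ = η * G := by field_simp

theorem ssmg_gradient_diff_bound
    (n d : ℕ) (hn : 1 ≤ n) (hd : 1 ≤ d)
    (f : Fin n → EuclideanSpace ℝ (Fin d) → ℝ)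
    (hf : ∀ i, Differentiable ℝ (f i))
    (F : EuclideanSpace ℝ (Fin d) → ℝ)
    (hF : F = fun x => (1 / (n : ℝ)) * ∑ i, f i x)
    (L : ℝ) (hL : 0 < L)
    (hsmooth : ∀ i x y, ‖gradient (f i) x - gradient (f i) y‖ ≤ L * ‖x - y‖)
    (G : ℝ) (hG : 0 < G)
    (hbg : ∀ i x, ‖gradient (f i) x‖ ≤ G)
    (T : ℕ) (hT : 1 ≤ T)
    (β : ℝ) (hβ0 : 0 ≤ β) (hβ1 : β < 1)
    (η : ℕ → ℝ) (hηpos : ∀ t, 1 ≤ t → t ≤ T → 0 < η t)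
    (π : Equiv.Perm (Fin n))
    (w m g : ℕ → ℕ → EuclideanSpace ℝ (Fin d))
    (wt mt : ℕ → EuclideanSpace ℝ (Fin d))
    (hmt0 : mt 0 = 0)
    (hw0 : ∀ t, 1 ≤ t → t ≤ T → w t 0 = wt (t - 1))
    (hm0 : ∀ t, 1 ≤ t → t ≤ T → m t 0 = mt (t - 1))
    (hg : ∀ t, 1 ≤ t → t ≤ T → ∀ i, ∀ hi : i < n,
        g t i = gradient (f (π ⟨i, hi⟩)) (w t i))
    (hm1 : ∀ t, 1 ≤ t → t ≤ T → ∀ i, i < n →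
        m t (i + 1) = β • m t i + (1 - β) • g t i)
    (hw1 : ∀ t, 1 ≤ t → t ≤ T → ∀ i, i < n →
        w t (i + 1) = w t i - (η t / (n : ℝ)) • m t (i + 1))
    (hwt : ∀ t, 1 ≤ t → t ≤ T → wt t = w t n)
    (hmt : ∀ t, 1 ≤ t → t ≤ T → mt t = m t n)
    :
    ∀ t, 2 ≤ t → t ≤ T → ∀ i, ∀ hi : i < n,
      ‖g t i - gradient (f (π ⟨i, hi⟩)) (w t 0)‖ ^ 2
          ≤ L ^ 2 * G ^ 2 * max (η t) (η (t - 1)) ^ 2 ∧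
      ‖g (t - 1) i - gradient (f (π ⟨i, hi⟩)) (w t 0)‖ ^ 2
          ≤ L ^ 2 * G ^ 2 * max (η t) (η (t - 1)) ^ 2 := by
  have hgn : ∀ t, 1 ≤ t → t ≤ T → ∀ i, i < n → ‖g t i‖ ≤ G := by
    intro t h1 h2 i hi
    rw [hg t h1 h2 i hi]
    exact hbg _ _
  have hmtn : ∀ t, t ≤ T → ‖mt t‖ ≤ G := by
    intro t
    induction t with
    | zero =>
      intro _
      rw [hmt0, norm_zero]
      exact hG.le
    | succ t ih =>
      intro h
      rw [hmt _ (by omega) h]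
      refine norm_movingAverage_le hβ0 hβ1.le ?_ (hgn _ (by omega) h) (hm1 _ (by omega) h) n le_rfl
      rw [hm0 _ (by omega) h]
      exact ih (by omega)
  have hmn : ∀ t, 1 ≤ t → t ≤ T → ∀ i, i ≤ n → ‖m t i‖ ≤ G := by
    intro t h1 h2
    refine norm_movingAverage_le hβ0 hβ1.le ?_ (hgn t h1 h2) (hm1 t h1 h2)
    rw [hm0 t h1 h2]
    exact hmtn _ (by omega)
  have hwn : ∀ t, 1 ≤ t → t ≤ T → ∀ i j, i ≤ j → j ≤ n → ‖w t i - w t j‖ ≤ η t * G :=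
    fun t h1 h2 i j hij hj =>
      norm_sub_le_of_steps (hηpos t h1 h2).le hG.le (hmn t h1 h2) (hw1 t h1 h2) hij hj
  have hgrad : ∀ k x y (ξ : ℝ), ‖x - y‖ ≤ ξ * G →
      ‖gradient (f k) x - gradient (f k) y‖ ^ 2 ≤ L ^ 2 * G ^ 2 * ξ ^ 2 := by
    intro k x y ξ h
    calc ‖gradient (f k) x - gradient (f k) y‖ ^ 2 ≤ (L * (ξ * G)) ^ 2 := by
          gcongr
          exact (hsmooth k x y).trans (by gcongr)
      _ = L ^ 2 * G ^ 2 * ξ ^ 2 := by ring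
  intro t h2 hT' i hi
  constructor
  · rw [hg t (by omega) hT' i hi]
    refine hgrad _ _ _ _ ?_
    rw [norm_sub_rev]
    exact (hwn t (by omega) hT' 0 i (by omega) hi.le).trans (by gcongr; exact le_max_left _ _)
  · rw [hg (t - 1) (by omega) (by omega) i hi]
    refine hgrad _ _ _ _ ?_
    rw [hw0 t (by omega) hT', hwt (t - 1) (by omega) (by omega)]
    exact (hwn (t - 1) (by omega) (by omega) i n hi.le le_rfl).trans
      (by gcongr; exact le_max_right _ _)
end
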